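/- arXiv:2508.02019 — 2 statements merged into one kernel-verified Lean document; each statement's English description precedes it below -/
import Mathlib

section
/- Let (H, α, β, ·, Δ, ε) be a Hopf algebroid over R. The family of K-vector spaces P_H(n) := H^{⊗_R n} (n ≥ 0), together with the composition maps γ(h; u₁,…,u_n) := (Δ^{k₁−1}h₁)·u₁ ⊗_R ⋯ ⊗_R (Δ^{k_n−1}h_n)·u_n for h = h₁⊗_R⋯⊗_R h_n ∈ P_H(n), u_i ∈ P_H(k_i), and the identity element 1 ∈ H = P_H(1), is a non-symmetric operad over K: the maps γ are well defined (independent of the chosen decomposition of h), the unitality axiom holds (γ(1; x) = x and γ(x; 1,…,1) = x), and the partial compositions h∘_i u := γ(h; 1,…,1, u, 1,…,1) (u in slot i) satisfy the sequential axiom (h∘_i u)∘_{i−1+j} v = h∘_i (u∘_j v) for h ∈ P_H(n), u ∈ P_H(m), 1 ≤ i ≤ n, 1 ≤ j ≤ m, and the parallel axiom (h∘_i u)∘_{k−1+m} v = (h∘_k v)∘_i u for 1 ≤ i < k ≤ n. -/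
/-! # Preliminaries: Hopf algebroids in the sense of Xu

We fix a field `K` of characteristic zero, an associative unital `K`-algebra `R` and an
associative unital `K`-algebra `H`.  We construct the `n`-fold tensor powers
`H^{⊗_K n}` of `H` over `K` and, given source and target maps `α, β : R → H`, the
quotients `H^{⊗_R n}` of `H^{⊗_K n}` by the right ideal `I_n` generated by the elements
`1 ⊗ ⋯ ⊗ β(r) ⊗ 1 ⊗ ⋯ ⊗ 1 − 1 ⊗ ⋯ ⊗ 1 ⊗ α(r) ⊗ ⋯ ⊗ 1`.

A Hopf algebroid is then given by the data `(H, α, β, ·, Δ, ε)` subject to the axioms of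
Xu; the iterated coproducts `Δⁿ = (Δ^{n−1} ⊗_R id) ∘ Δ` are part of the data, uniquely
characterized by their recursion.  All axioms involving maps induced on the quotients
`H^{⊗_R n}` are stated equivalently in terms of (arbitrary) lifts along the quotient
maps and (arbitrary) presentations of elements as sums of pure tensors. -/

noncomputable section

open scoped TensorProduct

universe u

variable (K : Type u) [Field K] [CharZero K]

/-- A bundled associative unital `K`-algebra. -/
structure BAlg : Type (u + 1) where
  carrier : Type u
  [isRing : Ring carrier]
  [isAlgebra : Algebra K carrier]

attribute [instance] BAlg.isRing BAlg.isAlgebra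

instance : CoeSort (BAlg K) (Type u) := ⟨BAlg.carrier⟩

variable (H : Type u) [Ring H] [Algebra K H]

/-- The `n`-fold tensor power `H^{⊗_K n}` of `H` over `K` (with `H^{⊗_K 0} = K` and
`H^{⊗_K 1} = H`), as a bundled `K`-algebra. -/
def TPa : ℕ → BAlg K
  | 0 => ⟨K⟩
  | 1 => ⟨H⟩
  | (n + 2) => ⟨(TPa (n + 1)) ⊗[K] H⟩

/-- The `n`-fold tensor power `H^{⊗_K n}`. -/
abbrev TP (n : ℕ) : Type u := TPa K H n

/-- The element of `H^{⊗_K n}` with `h` in slot `i` (`0`-indexed) and `1` in all other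
slots. -/
def slotP : (n : ℕ) → ℕ → H → TP K H n
  | 0, _, _ => 1
  | 1, _, h => h
  | (n + 2), i, h =>
      if i = n + 1 then ((1 : TP K H (n + 1)) ⊗ₜ[K] h : TP K H (n + 1) ⊗[K] H)
      else ((slotP (n + 1) i h) ⊗ₜ[K] (1 : H) : TP K H (n + 1) ⊗[K] H)

/-- The pure tensor `x₀ ⊗ x₁ ⊗ ⋯ ⊗ x_{n-1} ∈ H^{⊗_K n}`, written as the product of its
slot components. -/
def chainP (n : ℕ) (x : Fin n → H) : TP K H n :=
  (List.ofFn (fun i : Fin n => slotP K H n (i : ℕ) (x i))).prod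

variable {R : Type u} [Ring R] [Algebra K R]

/-- The relator `1 ⊗ ⋯ ⊗ β(r) ⊗ 1 ⊗ ⋯ ⊗ 1 − 1 ⊗ ⋯ ⊗ 1 ⊗ α(r) ⊗ ⋯ ⊗ 1` with `β(r)` in
slot `i` and `α(r)` in slot `i + 1` (`0`-indexed). -/
def relator (αf βf : R → H) (n : ℕ) (r : R) (i : ℕ) : TP K H n :=
  slotP K H n i (βf r) - slotP K H n (i + 1) (αf r)

/-- The right ideal `I_n ⊆ H^{⊗_K n}` generated by the relators. -/
def Idl (αf βf : R → H) (n : ℕ) : Submodule K (TP K H n) :=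
  Submodule.span K
    {z | ∃ (r : R) (i : ℕ) (x : TP K H n), i + 2 ≤ n ∧ z = relator K H αf βf n r i * x}

/-- The `n`-fold tensor power `H^{⊗_R n} := H^{⊗_K n} / I_n` of `H` over `R`
(`H^{⊗_R 1} = H` and, by convention, `H^{⊗_R 0} = R` is treated separately). -/
abbrev QT (αf βf : R → H) (n : ℕ) : Type u := TP K H n ⧸ Idl K H αf βf n

/-- The quotient map `H^{⊗_K n} → H^{⊗_R n}`. -/
abbrev qtMk (αf βf : R → H) (n : ℕ) : TP K H n →ₗ[K] QT K H αf βf n :=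
  (Idl K H αf βf n).mkQ

variable (R)

/-- A Hopf algebroid `(H, α, β, ·, Δ, ε)` over `R`, in the sense of Xu, together with its
(uniquely characterized) iterated coproducts `Δⁿ`.  The source map `α` (an algebra
homomorphism) and the target map `β` (an algebra anti-homomorphism) are taken as
parameters.  All conditions on elements of the quotients `H^{⊗_R n}` are expressed via
arbitrary lifts along the quotient maps. -/
structure HopfAlgebroid (α : R →ₐ[K] H) (β : R →ₗ[K] H) : Type u where
  β_one : β 1 = 1
  /-- `β` is an algebra anti-homomorphism -/
  β_mul : ∀ a b : R, β (a * b) = β b * β a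
  /-- the images of `α` and `β` commute -/
  αβ_comm : ∀ a b : R, α a * β b = β b * α a
  /-- the coproduct -/
  Δ : H →ₗ[K] QT K H (fun a => α a) (fun a => β a) 2
  Δ_one : Δ 1 = qtMk K H (fun a => α a) (fun a => β a) 2 1
  /-- `Δ(x) · (β(a) ⊗ 1 − 1 ⊗ α(a)) = 0` -/
  Δ_compat : ∀ (x : H) (a : R) (s : TP K H 2),
    qtMk K H (fun a => α a) (fun a => β a) 2 s = Δ x →
    qtMk K H (fun a => α a) (fun a => β a) 2
      (s * relator K H (fun a => α a) (fun a => β a) 2 a 0) = 0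
  /-- `Δ(x₁ x₂) = Δ(x₁) · Δ(x₂)` -/
  Δ_mul : ∀ (x y : H) (s t : TP K H 2),
    qtMk K H (fun a => α a) (fun a => β a) 2 s = Δ x →
    qtMk K H (fun a => α a) (fun a => β a) 2 t = Δ y →
    Δ (x * y) = qtMk K H (fun a => α a) (fun a => β a) 2 (s * t)
  /-- `Δ` is a morphism of `(R,R)`-bimodules, left action -/
  Δ_bimod_left : ∀ (a : R) (x : H) (s : TP K H 2),
    qtMk K H (fun a => α a) (fun a => β a) 2 s = Δ x →
    Δ (α a * x) = qtMk K H (fun a => α a) (fun a => β a) 2 (slotP K H 2 0 (α a) * s)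
  /-- `Δ` is a morphism of `(R,R)`-bimodules, right action -/
  Δ_bimod_right : ∀ (a : R) (x : H) (s : TP K H 2),
    qtMk K H (fun a => α a) (fun a => β a) 2 s = Δ x →
    Δ (β a * x) = qtMk K H (fun a => α a) (fun a => β a) 2 (slotP K H 2 1 (β a) * s)
  /-- coassociativity `(Δ ⊗_R id) ∘ Δ = (id ⊗_R Δ) ∘ Δ` -/
  coassoc : ∀ (x : H) (C : ℕ) (uu vv : Fin C → H),
    qtMk K H (fun a => α a) (fun a => β a) 2 (∑ c, (uu c ⊗ₜ[K] vv c : TP K H 2)) = Δ x →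
    ∀ s t : Fin C → TP K H 2,
      (∀ c, qtMk K H (fun a => α a) (fun a => β a) 2 (s c) = Δ (uu c)) →
      (∀ c, qtMk K H (fun a => α a) (fun a => β a) 2 (t c) = Δ (vv c)) →
      qtMk K H (fun a => α a) (fun a => β a) 3 (∑ c, (s c ⊗ₜ[K] vv c : TP K H 3)) =
        qtMk K H (fun a => α a) (fun a => β a) 3
          (∑ c, (TensorProduct.assoc K H H H).symm (uu c ⊗ₜ[K] t c))
  /-- the counit -/
  ε : H →ₗ[K] R
  ε_one : ε 1 = 1
  ε_bimod_left : ∀ (a : R) (x : H), ε (α a * x) = a * ε x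
  ε_bimod_right : ∀ (a : R) (x : H), ε (β a * x) = ε x * a
  /-- `(ε ⊗_R id) ∘ Δ = id` -/
  counit_left : ∀ (x : H) (C : ℕ) (uu vv : Fin C → H),
    qtMk K H (fun a => α a) (fun a => β a) 2 (∑ c, (uu c ⊗ₜ[K] vv c : TP K H 2)) = Δ x →
    ∑ c, α (ε (uu c)) * vv c = x
  /-- `(id ⊗_R ε) ∘ Δ = id` -/
  counit_right : ∀ (x : H) (C : ℕ) (uu vv : Fin C → H),
    qtMk K H (fun a => α a) (fun a => β a) 2 (∑ c, (uu c ⊗ₜ[K] vv c : TP K H 2)) = Δ x →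
    ∑ c, β (ε (vv c)) * uu c = x
  /-- `ker ε` is a left ideal of `H` -/
  ker_ε_ideal : ∀ x y : H, ε y = 0 → ε (x * y) = 0
  /-- the iterated coproducts `Δⁿ : H → H^{⊗_R (n+1)}` -/
  Δpow : ∀ n : ℕ, H →ₗ[K] QT K H (fun a => α a) (fun a => β a) (n + 1)
  Δpow_zero : ∀ x : H, Δpow 0 x = qtMk K H (fun a => α a) (fun a => β a) 1 x
  Δpow_one : Δpow 1 = Δ
  /-- `Δ^{n+1} = (Δⁿ ⊗_R id) ∘ Δ` -/
  Δpow_succ : ∀ (n : ℕ) (x : H) (C : ℕ) (uu vv : Fin C → H),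
    qtMk K H (fun a => α a) (fun a => β a) 2 (∑ c, (uu c ⊗ₜ[K] vv c : TP K H 2)) = Δ x →
    ∀ s : Fin C → TP K H (n + 1),
      (∀ c, qtMk K H (fun a => α a) (fun a => β a) (n + 1) (s c) = Δpow n (uu c)) →
      Δpow (n + 1) x =
        qtMk K H (fun a => α a) (fun a => β a) (n + 2)
          (∑ c, (s c ⊗ₜ[K] vv c : TP K H (n + 2)))

namespace HopfAlgebroid

variable {K H R}
variable {α : R →ₐ[K] H} {β : R →ₗ[K] H} (D : HopfAlgebroid K H R α β)

/-- The left `H`-module structure `h ▷ a := ε(h · α(a))` on `R`. -/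
def hAct (h : H) (a : R) : R := D.ε (h * α a)

end HopfAlgebroid

/-- The sign `(-1)^t` in the field `K`, for an integer exponent `t`. -/
def sgn (K : Type u) [Field K] (t : ℤ) : K := ((((-1 : Kˣ)) ^ t : Kˣ) : K)
/-! ### The graded space `⊕ₙ H^{⊗_R n}` -/

/-- Splicing a pure tensor: replace the slot `i` of `x₀ ⊗ ⋯ ⊗ x_n` by `u ⊗ v`. -/
def spliceAt {H : Type u} {n : ℕ} (x : Fin (n + 1) → H) (i : Fin (n + 1)) (u v : H) :
    Fin (n + 2) → H := fun j =>
  if _ : (j : ℕ) < (i : ℕ) then x ⟨(j : ℕ), by omega⟩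
  else if _ : (j : ℕ) = (i : ℕ) then u
  else if _ : (j : ℕ) = (i : ℕ) + 1 then v
  else x ⟨(j : ℕ) - 1, by have := j.isLt; omega⟩

section GradedSpace

variable (K : Type u) [Field K] [CharZero K]
variable (H : Type u) [Ring H] [Algebra K H]
variable {R : Type u} [Ring R] [Algebra K R]
variable (αf βf : R → H)

/-- The degree-`n` component `P_H(n)` of the graded space `⊕ₙ H^{⊗_R n}[-n]`:
`P_H(0) = R` and `P_H(n) = H^{⊗_R n}` for `n ≥ 1`. -/
@[reducible] def PH : ℕ → Type u
  | 0 => R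
  | (n + 1) => QT K H αf βf (n + 1)

instance PH.instAddCommGroup : ∀ n : ℕ, AddCommGroup (PH K H αf βf n)
  | 0 => inferInstanceAs (AddCommGroup R)
  | (n + 1) => inferInstanceAs (AddCommGroup (QT K H αf βf (n + 1)))

instance PH.instModule : ∀ n : ℕ, Module K (PH K H αf βf n)
  | 0 => inferInstanceAs (Module K R)
  | (n + 1) => inferInstanceAs (Module K (QT K H αf βf (n + 1)))

/-- Transport along an equality of degrees. -/
def phCast {a b : ℕ} (h : a = b) (x : PH K H αf βf a) : PH K H αf βf b := h ▸ x

end GradedSpace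
/-- Inserting a block `b` of length `m + 1` into slot `i` of the pure tensor
`x₀ ⊗ ⋯ ⊗ x_n` (the slot `i` is deleted; it is consumed by the block). -/
def insChain {H : Type u} {n m : ℕ} (i : Fin (n + 1)) (x : Fin (n + 1) → H)
    (b : Fin (m + 1) → H) : Fin (n + (m + 1)) → H := fun j =>
  if h1 : (j : ℕ) < (i : ℕ) then x ⟨(j : ℕ), by omega⟩
  else if h2 : (j : ℕ) < (i : ℕ) + (m + 1) then b ⟨(j : ℕ) - (i : ℕ), by omega⟩
  else x ⟨(j : ℕ) - m, by have := j.isLt; have := i.isLt; omega⟩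
set_option linter.unusedSectionVars false

namespace HopfOp

section tp
variable {K H R}
variable {M : Type*} [AddCommGroup M] [Module K M]

def tmul (n : ℕ) : TP K H (n+1) →ₗ[K] H →ₗ[K] TP K H (n+2) :=
  TensorProduct.mk K (TP K H (n+1)) H

def tlift (n : ℕ) (f : TP K H (n+1) →ₗ[K] H →ₗ[K] M) : TP K H (n+2) →ₗ[K] M :=
  TensorProduct.lift f

theorem tlift_tmul (n : ℕ) (f : TP K H (n+1) →ₗ[K] H →ₗ[K] M) (t : TP K H (n+1)) (h : H) :
    tlift n f (tmul n t h) = f t h := TensorProduct.lift.tmul t h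

theorem tind {n : ℕ} {p : TP K H (n+2) → Prop} (x : TP K H (n+2)) (h0 : p 0)
    (h1 : ∀ t h, p (tmul n t h)) (h2 : ∀ x y, p x → p y → p (x+y)) : p x :=
  TensorProduct.induction_on (motive := p) x h0 h1 h2

theorem tmul_mul (n : ℕ) (a b : TP K H (n+1)) (h g : H) :
    tmul n a h * tmul n b g = tmul n (a*b) (h*g) :=
  Algebra.TensorProduct.tmul_mul_tmul a b h g

theorem tone (n : ℕ) : (1 : TP K H (n+2)) = tmul n 1 1 := rfl

theorem slot_succ (n i : ℕ) (h : H) : slotP K H (n+2) i h =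
    if i = n+1 then tmul n 1 h else tmul n (slotP K H (n+1) i h) 1 := rfl

theorem slot_last (n : ℕ) (h : H) : slotP K H (n+2) (n+1) h = tmul n 1 h := by
  rw [slot_succ, if_pos rfl]

theorem slot_lt (n i : ℕ) (hi : i < n+1) (h : H) : slotP K H (n+2) i h =
    tmul n (slotP K H (n+1) i h) 1 := by
  rw [slot_succ, if_neg (by omega)]

theorem slot_one (n i : ℕ) : slotP K H (n+1) i (1:H) = 1 := by
  induction n with
  | zero => rfl
  | succ n ih => rw [slot_succ]; split_ifs <;> simp [ih, tone]

/-- chain recursion -/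
theorem chain_zero (x : Fin 1 → H) : chainP K H 1 x = x 0 := by
  simp [chainP]; rfl

theorem tmul_prod_one (n : ℕ) (l : List (TP K H (n+1))) :
    (l.map (fun t => tmul n t (1:H))).prod = tmul n l.prod 1 := by
  induction l with
  | nil => rfl
  | cons a l ih => simp [ih, tmul_mul]

theorem chain_succ (n : ℕ) (x : Fin (n+2) → H) : chainP K H (n+2) x =
    tmul n (chainP K H (n+1) (fun j => x j.castSucc)) (x (Fin.last _)) := by
  unfold chainP
  rw [List.ofFn_succ', List.concat_eq_append, List.prod_append]
  have : (List.ofFn fun i : Fin (n+1) => slotP K H (n+2) (i.castSucc : ℕ) (x i.castSucc)) =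
     (List.ofFn fun i : Fin (n+1) => slotP K H (n+1) (i : ℕ) (x i.castSucc)).map
       (fun t => tmul n t (1:H)) := by
    rw [List.map_ofFn]
    congr 1
    funext i
    exact slot_lt n i i.2 _
  rw [this, tmul_prod_one]
  simp only [Fin.val_last, List.prod_singleton, slot_last, tmul_mul, one_mul, mul_one]

theorem chain_span (n : ℕ) : ∀ t : TP K H (n+1), ∃ (C : ℕ) (z : Fin C → Fin (n+1) → H),
    t = ∑ c, chainP K H (n+1) (z c) := by
  induction n with
  | zero => intro t; exact ⟨1, fun _ _ => t, by
      rw [Fin.sum_univ_one]; exact (chain_zero (fun _ => t)).symm⟩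
  | succ n ih =>
    intro t
    induction t using tind with
    | h0 => exact ⟨0, fun _ _ => 0, by simp⟩
    | h1 t h =>
      obtain ⟨C, z, rfl⟩ := ih t
      refine ⟨C, fun c => Fin.snoc (z c) h, ?_⟩
      simp [chain_succ]
    | h2 x y hx hy =>
      obtain ⟨C, z, rfl⟩ := hx
      obtain ⟨C', z', rfl⟩ := hy
      refine ⟨C + C', Fin.append z z', ?_⟩
      simp [Fin.sum_univ_add]
end tp

section models
variable {K H R}
variable {α : R →ₐ[K] H} {β : R →ₗ[K] H}
variable {T : Type u} [Ring T] [Algebra K T]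

abbrev Pp (α : R →ₐ[K] H) (β : R →ₗ[K] H) (n : ℕ) : Type u :=
  PH K H (fun a => α a) (fun a => β a) n

abbrev rel (α : R →ₐ[K] H) (β : R →ₗ[K] H) (n : ℕ) (r : R) (i : ℕ) : TP K H n :=
  relator K H (fun a => α a) (fun a => β a) n r i

abbrev Ix (α : R →ₐ[K] H) (β : R →ₗ[K] H) (n : ℕ) : Submodule K (TP K H n) :=
  Idl K H (fun a => α a) (fun a => β a) n

def pmk (α : R →ₐ[K] H) (β : R →ₗ[K] H) (n : ℕ) : TP K H (n+1) →ₗ[K] Pp α β (n+1) :=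
  qtMk K H (fun a => α a) (fun a => β a) (n+1)

theorem pmk_surj (n : ℕ) : Function.Surjective (pmk α β n) :=
  Submodule.mkQ_surjective _

theorem pmk_eq_iff {n : ℕ} {s t : TP K H (n+1)} :
    pmk α β n s = pmk α β n t ↔ s - t ∈ Ix α β (n+1) :=
  Submodule.Quotient.eq _

theorem pmk_rel (n : ℕ) (r : R) (i : ℕ) (hi : i + 2 ≤ n + 1) (x : TP K H (n+1)) :
    pmk α β n (rel α β (n+1) r i * x) = 0 :=
  (Submodule.Quotient.mk_eq_zero _).2 (Submodule.subset_span ⟨r, i, x, hi, rfl⟩)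

theorem pmk_slot (n : ℕ) (r : R) (i : ℕ) (hi : i + 2 ≤ n + 1) (x : TP K H (n+1)) :
    pmk α β n (slotP K H (n+1) i (β r) * x) = pmk α β n (slotP K H (n+1) (i+1) (α r) * x) := by
  have := pmk_rel (α := α) (β := β) n r i hi x
  simp only [rel, relator, sub_mul, map_sub] at this
  exact sub_eq_zero.1 this

theorem Ix_mul {n : ℕ} {s : TP K H n} (hs : s ∈ Ix α β n) (t : TP K H n) : s * t ∈ Ix α β n := by
  refine Submodule.span_induction (p := fun s _ => s * t ∈ Ix α β n) ?_ ?_ ?_ ?_ hs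
  · rintro _ ⟨r, i, x, hi, rfl⟩
    exact Submodule.subset_span ⟨r, i, x * t, hi, by rw [mul_assoc]⟩
  · simp
  · intro x y _ _ hx hy; rw [add_mul]; exact Submodule.add_mem _ hx hy
  · intro a x _ hx; rw [smul_mul_assoc]; exact Submodule.smul_mem _ _ hx

theorem pmk_mul {n : ℕ} {s s' : TP K H (n+1)} (h : pmk α β n s = pmk α β n s') (t : TP K H (n+1)) :
    pmk α β n (s * t) = pmk α β n (s' * t) := by
  rw [pmk_eq_iff] at h ⊢
  rw [← sub_mul]
  exact Ix_mul h t

def plift {M : Type*} [AddCommGroup M] [Module K M] (n : ℕ) (f : TP K H (n+1) →ₗ[K] M)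
    (hf : ∀ r i x, i + 2 ≤ n + 1 → f (rel α β (n+1) r i * x) = 0) : Pp α β (n+1) →ₗ[K] M :=
  (Ix α β (n+1)).liftQ f (by
    refine Submodule.span_le.2 ?_
    rintro _ ⟨r, i, x, hi, rfl⟩
    exact hf r i x hi)

theorem plift_mk {M : Type*} [AddCommGroup M] [Module K M] (n : ℕ) (f : TP K H (n+1) →ₗ[K] M)
    (hf : ∀ r i x, i + 2 ≤ n + 1 → f (rel α β (n+1) r i * x) = 0) (t : TP K H (n+1)) :
    plift (α := α) (β := β) n f hf (pmk α β n t) = f t := rfl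

/-- bimodule maps -/
def bm (α : R →ₐ[K] H) (β : R →ₗ[K] H) (ρ : R →ₐ[K] T) : Submodule K (H →ₗ[K] T) where
  carrier := {φ | (∀ r h, φ (α r * h) = ρ r * φ h) ∧ (∀ r h, φ (β r * h) = φ h * ρ r)}
  zero_mem' := by simp
  add_mem' := by
    rintro a b ⟨h1, h2⟩ ⟨h3, h4⟩
    exact ⟨fun r h => by simp [h1, h3, mul_add], fun r h => by simp [h2, h4, add_mul]⟩
  smul_mem' := by
    rintro c a ⟨h1, h2⟩
    exact ⟨fun r h => by simp [h1], fun r h => by simp [h2]⟩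

variable {ρ : R →ₐ[K] T}

def tprod (Φ : ℕ → bm α β ρ) : (n : ℕ) → (TP K H (n+1) →ₗ[K] T)
  | 0 => (Φ 0).1
  | n+1 => tlift n ((LinearMap.mul K T).compl₁₂ (tprod Φ n) (Φ (n+1)).1)

theorem tprod_zero (Φ : ℕ → bm α β ρ) (h : H) : tprod Φ 0 h = (Φ 0).1 h := rfl

theorem tprod_succ (Φ : ℕ → bm α β ρ) (n : ℕ) (t : TP K H (n+1)) (h : H) :
    tprod Φ (n+1) (tmul n t h) = tprod Φ n t * (Φ (n+1)).1 h := by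
  simp [tprod, tlift_tmul]

theorem tprod_last (Φ : ℕ → bm α β ρ) (n : ℕ) (r : R) (t : TP K H (n+1)) :
    tprod Φ n (slotP K H (n+1) n (β r) * t) = tprod Φ n t * ρ r := by
  cases n with
  | zero => exact (Φ 0).2.2 r t
  | succ n =>
    induction t using tind with
    | h0 => simp
    | h1 t h => rw [slot_last, tmul_mul, tprod_succ, tprod_succ, one_mul, (Φ (n+1)).2.2, mul_assoc]
    | h2 x y hx hy => rw [mul_add, map_add, hx, hy, map_add, add_mul]

theorem tprod_rel (Φ : ℕ → bm α β ρ) (n : ℕ) : ∀ (r : R) (i : ℕ) (x : TP K H (n+1)),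
    i + 2 ≤ n + 1 → tprod Φ n (rel α β (n+1) r i * x) = 0 := by
  induction n with
  | zero => intro r i x hi; omega
  | succ n ih =>
    intro r i x hi
    induction x using tind with
    | h0 => simp
    | h1 t h =>
      rcases Nat.lt_or_ge (i+1) (n+1) with h1 | h1
      · have := ih r i t (by omega)
        simp only [rel, relator, sub_mul, map_sub] at this ⊢
        rw [slot_lt _ _ (by omega), slot_lt _ _ (by omega), tmul_mul, tmul_mul, tprod_succ,
          tprod_succ, ← sub_mul, this, zero_mul]
      · obtain rfl : i = n := by omega
        simp only [rel, relator, sub_mul, map_sub]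
        rw [slot_lt _ _ (by omega), slot_last, tmul_mul, tmul_mul, tprod_succ,
          tprod_succ, tprod_last, one_mul, one_mul, (Φ _).2.1, mul_assoc, sub_self]
    | h2 x y hx hy => rw [mul_add, map_add, hx, hy, add_zero]

def pprod (Φ : ℕ → bm α β ρ) : (n : ℕ) → (Pp α β n →ₗ[K] T)
  | 0 => ρ.toLinearMap
  | n+1 => plift n (tprod Φ n) (tprod_rel Φ n)

theorem pprod_zero (Φ : ℕ → bm α β ρ) (r : R) : pprod Φ 0 r = ρ r := rfl
theorem pprod_mk (Φ : ℕ → bm α β ρ) (n : ℕ) (t : TP K H (n+1)) :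
    pprod Φ (n+1) (pmk α β n t) = tprod Φ n t := rfl

/-- noncommutative product -/
def pr (f : ℕ → T) : ℕ → T
  | 0 => 1
  | n+1 => pr f n * f n

theorem pr_add (f : ℕ → T) (a b : ℕ) : pr f (a+b) = pr f a * pr (fun j => f (a+j)) b := by
  induction b with
  | zero => simp [pr]
  | succ b ih => rw [← add_assoc]; simp only [pr]; rw [ih, mul_assoc]

theorem pr_congr {f g : ℕ → T} {n : ℕ} (h : ∀ j < n, f j = g j) : pr f n = pr g n := by
  induction n with
  | zero => rfl
  | succ n ih => simp only [pr]; rw [ih (fun j hj => h j (by omega)), h n (by omega)]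

theorem pr_one (f : ℕ → T) : pr f 1 = f 0 := by simp [pr]

theorem pr_split (f : ℕ → T) (N i : ℕ) (hi : i < N) :
    pr f N = pr f i * f i * pr (fun j => f (i+1+j)) (N-(i+1)) := by
  obtain ⟨q, rfl⟩ : ∃ q, N = i + 1 + q := ⟨N-(i+1), by omega⟩
  rw [pr_add]; simp [pr]

def word (α : R →ₐ[K] H) (β : R →ₗ[K] H) : (n : ℕ) → (ℕ → H) → Pp α β n
  | 0, _ => (1 : R)
  | n+1, X => pmk α β n (chainP K H (n+1) (fun j => X j))

theorem tprod_chain (Φ : ℕ → bm α β ρ) (X : ℕ → H) (n : ℕ) :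
    tprod Φ n (chainP K H (n+1) (fun j => X j)) = pr (fun j => (Φ j).1 (X j)) (n+1) := by
  induction n with
  | zero => rw [chain_zero, tprod_zero]; simp [pr]
  | succ n ih =>
    rw [chain_succ, tprod_succ, pr]
    simp only [Fin.val_castSucc, Fin.val_last, ih]

theorem pprod_word (Φ : ℕ → bm α β ρ) (X : ℕ → H) (n : ℕ) :
    pprod Φ n (word α β n X) = pr (fun j => (Φ j).1 (X j)) n := by
  cases n with
  | zero => exact map_one ρ
  | succ n => exact tprod_chain Φ X n

theorem word_span (n : ℕ) (w : Pp α β (n+1)) : ∃ (C : ℕ) (X : Fin C → ℕ → H),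
    w = ∑ c, word α β (n+1) (X c) := by
  obtain ⟨t, rfl⟩ := pmk_surj n w
  obtain ⟨C, z, rfl⟩ := chain_span n t
  refine ⟨C, fun c j => if h : j < n+1 then z c ⟨j, h⟩ else 0, ?_⟩
  rw [map_sum]
  refine Finset.sum_congr rfl fun c _ => ?_
  rw [word]
  congr 2
  funext j
  simp only [Fin.is_lt, dite_true]

theorem word_ind {n : ℕ} {p : Pp α β (n+1) → Prop} (w : Pp α β (n+1)) (h0 : p 0)
    (h1 : ∀ X, p (word α β (n+1) X)) (h2 : ∀ x y, p x → p y → p (x+y)) : p w := by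
  obtain ⟨C, X, rfl⟩ := word_span n w
  exact Finset.sum_induction _ p h2 h0 (fun c _ => h1 _)

end models

section cat
variable {K H R}
variable {α : R →ₐ[K] H} {β : R →ₗ[K] H}

def IsCat (p m q N : ℕ) (X : ℕ → H) (w' : Pp α β m) (Y : ℕ → H) (w : Pp α β N) : Prop :=
  ∀ (T : Type u) [Ring T] [Algebra K T] (ρ : R →ₐ[K] T) (Φ : ℕ → bm α β ρ),
    pprod Φ N w = pr (fun j => (Φ j).1 (X j)) p * pprod (fun j => Φ (p+j)) m w' *
      pr (fun j => (Φ (p+m+j)).1 (Y j)) q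

theorem exists_cat (p m q N : ℕ) (hN : N = p+m+q) (X : ℕ → H) (w' : Pp α β m) (Y : ℕ → H) :
    ∃ w : Pp α β N, IsCat p m q N X w' Y w := by
  subst hN
  cases m with
  | zero =>
    rcases Nat.eq_zero_or_pos q with rfl | hq
    · rcases Nat.eq_zero_or_pos p with rfl | hp
      · refine ⟨w', fun T _ _ ρ Φ => ?_⟩
        simp only [pr, one_mul, mul_one]
        rfl
      · obtain ⟨p, rfl⟩ : ∃ p', p = p'+1 := ⟨p-1, by omega⟩
        refine ⟨word α β _ (fun j => if j = p then β w' * X j else X j), fun T _ _ ρ Φ => ?_⟩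
        rw [pprod_word, pprod_zero]
        simp only [pr, mul_one, if_true]
        rw [(Φ p).2.2, ← mul_assoc]
        congr 2
        apply pr_congr
        intro j hj
        rw [if_neg (by omega)]
    · obtain ⟨q, rfl⟩ : ∃ q', q = q'+1 := ⟨q-1, by omega⟩
      refine ⟨word α β _ (fun j => if j < p then X j else if j = p then α w' * Y 0 else Y (j-p)),
        fun T _ _ ρ Φ => ?_⟩
      rw [pprod_word, pprod_zero, pr_add, Nat.add_zero]
      rw [mul_assoc]
      congr 1
      · apply pr_congr
        intro j hj
        rw [if_pos hj]
      · rw [Nat.add_comm q 1, pr_add, pr_add, pr_one, pr_one, ← mul_assoc]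
        congr 1
        · simp only [Nat.add_zero, lt_irrefl, if_false, if_true]
          rw [(Φ p).2.1]
        · apply pr_congr
          intro j hj
          rw [if_neg (by omega), if_neg (by omega)]
          congr 2
          omega
  | succ m =>
    induction w' using word_ind with
    | h0 => exact ⟨0, fun T _ _ ρ Φ => by simp⟩
    | h1 W =>
      refine ⟨word α β _ (fun j => if j < p then X j else if j < p+(m+1) then W (j-p)
        else Y (j-(p+(m+1)))), fun T _ _ ρ Φ => ?_⟩
      rw [pprod_word, pprod_word, pr_add, pr_add]
      congr 1
      · congr 1
        · apply pr_congr
          intro j hj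
          rw [if_pos hj]
        · apply pr_congr
          intro j hj
          rw [if_neg (by omega), if_pos (by omega)]
          congr 2
          omega
      · apply pr_congr
        intro j hj
        rw [if_neg (by omega), if_neg (by omega)]
        congr 2
        omega
    | h2 x y hx hy =>
      obtain ⟨a, ha⟩ := hx
      obtain ⟨b, hb⟩ := hy
      exact ⟨a + b, fun T _ _ ρ Φ => by
        rw [map_add, ha, hb, map_add, mul_add, add_mul]⟩

end cat

section model0
variable {K H R}
variable {α : R →ₐ[K] H} {β : R →ₗ[K] H} (D : HopfAlgebroid K H R α β)

theorem slot_mul (n i : ℕ) (a b : H) :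
    slotP K H (n+1) i a * slotP K H (n+1) i b = slotP K H (n+1) i (a*b) := by
  induction n with
  | zero => rfl
  | succ n ih => rw [slot_succ, slot_succ, slot_succ]; split_ifs <;> simp [tmul_mul, ih]

theorem slot_comm (n i j : ℕ) (hi : i < n+1) (hj : j < n+1) (hij : i ≠ j) (a b : H) :
    slotP K H (n+1) i a * slotP K H (n+1) j b = slotP K H (n+1) j b * slotP K H (n+1) i a := by
  induction n with
  | zero => omega
  | succ n ih =>
    rw [slot_succ, slot_succ]
    split_ifs with h1 h2
    · omega
    · simp [tmul_mul]
    · simp [tmul_mul]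
    · rw [tmul_mul, tmul_mul, ih (by omega) (by omega)]

def slotL (n i : ℕ) : H →ₗ[K] TP K H (n+1) where
  toFun := slotP K H (n+1) i
  map_add' a b := by
    induction n with
    | zero => rfl
    | succ n ih => rw [slot_succ, slot_succ, slot_succ]; split_ifs <;> simp [ih]
  map_smul' c a := by
    induction n with
    | zero => rfl
    | succ n ih => rw [slot_succ, slot_succ]; split_ifs <;> simp_all

/-- concatenation with one element -/
def catR (α : R →ₐ[K] H) (β : R →ₗ[K] H) (n : ℕ) :
    Pp α β (n+1) →ₗ[K] H →ₗ[K] Pp α β (n+2) :=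
  plift n ((tmul n).compr₂ (pmk α β (n+1))) (by
    intro r i x hi
    ext h
    have := pmk_rel (α := α) (β := β) (n+1) r i (by omega) (tmul n x h)
    simp only [rel, relator, sub_mul, map_sub] at this ⊢
    rw [slot_lt _ _ (by omega), slot_lt _ _ (by omega), tmul_mul, tmul_mul, one_mul] at this
    exact this)

theorem catR_mk (n : ℕ) (t : TP K H (n+1)) (h : H) :
    catR α β n (pmk α β n t) h = pmk α β (n+1) (tmul n t h) := rfl

theorem slot_rel (D : HopfAlgebroid K H R α β) (n : ℕ) (r s : R) (i : ℕ) (hi : i + 2 ≤ n+1) :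
    slotP K H (n+1) n (β s) * rel α β (n+1) r i = rel α β (n+1) r i * slotP K H (n+1) n (β s) := by
  simp only [rel, relator, mul_sub, sub_mul]
  congr 1
  · exact slot_comm _ _ _ (by omega) (by omega) (by omega) _ _
  · rcases eq_or_ne (i+1) n with h | h
    · rw [h, slot_mul, slot_mul, D.αβ_comm]
    · exact slot_comm _ _ _ (by omega) (by omega) (by omega) _ _

def rβ (n : ℕ) : R →ₗ[K] Pp α β (n+1) →ₗ[K] Pp α β (n+1) where
  toFun r := plift n ((pmk α β n) ∘ₗ LinearMap.mulLeft K (slotP K H (n+1) n (β r))) (by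
    intro s i x hi
    simp only [LinearMap.comp_apply, LinearMap.mulLeft_apply]
    rw [← mul_assoc, slot_rel D _ _ _ _ hi, mul_assoc, pmk_rel _ _ _ hi])
  map_add' a b := by
    refine LinearMap.ext fun x => ?_
    obtain ⟨t, rfl⟩ := pmk_surj n x
    change pmk α β n (slotP K H (n+1) n (β (a + b)) * t) =
      pmk α β n (slotP K H (n+1) n (β a) * t) + pmk α β n (slotP K H (n+1) n (β b) * t)
    have := (slotL (K := K) n n).map_add (β a) (β b)
    simp only [slotL, LinearMap.coe_mk, AddHom.coe_mk] at this
    rw [map_add, this, add_mul, map_add]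
  map_smul' c a := by
    refine LinearMap.ext fun x => ?_
    obtain ⟨t, rfl⟩ := pmk_surj n x
    change pmk α β n (slotP K H (n+1) n (β (c • a)) * t) =
      c • pmk α β n (slotP K H (n+1) n (β a) * t)
    have := (slotL (K := K) n n).map_smul c (β a)
    simp only [slotL, LinearMap.coe_mk, AddHom.coe_mk] at this
    rw [map_smul, this, smul_mul_assoc, map_smul]

theorem rβ_mk (n : ℕ) (r : R) (t : TP K H (n+1)) :
    rβ D n r (pmk α β n t) = pmk α β n (slotP K H (n+1) n (β r) * t) := rfl

theorem rβ_one (n : ℕ) (x : Pp α β (n+1)) : rβ D n 1 x = x := by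
  obtain ⟨t, rfl⟩ := pmk_surj n x
  rw [rβ_mk, D.β_one, slot_one, one_mul]

theorem rβ_mul (n : ℕ) (r s : R) (x : Pp α β (n+1)) :
    rβ D n (r*s) x = rβ D n s (rβ D n r x) := by
  obtain ⟨t, rfl⟩ := pmk_surj n x
  rw [rβ_mk, rβ_mk, rβ_mk, D.β_mul, ← slot_mul, mul_assoc]

theorem catR_rβ (n : ℕ) (r : R) (x : Pp α β (n+1)) (h : H) :
    catR α β n (rβ D n r x) h = catR α β n x (α r * h) := by
  obtain ⟨t, rfl⟩ := pmk_surj n x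
  rw [rβ_mk, catR_mk, catR_mk]
  have := pmk_slot (α := α) (β := β) (n+1) r n (by omega) (tmul n t h)
  rwa [slot_lt _ _ (by omega), slot_last, tmul_mul, tmul_mul, one_mul, one_mul] at this

theorem rβ_catR (n : ℕ) (r : R) (x : Pp α β (n+1)) (h : H) :
    rβ D (n+1) r (catR α β n x h) = catR α β n x (β r * h) := by
  obtain ⟨t, rfl⟩ := pmk_surj n x
  rw [catR_mk, catR_mk, rβ_mk, slot_last, tmul_mul, one_mul]

abbrev NN (α : R →ₐ[K] H) (β : R →ₗ[K] H) : Type u := ∀ n, Pp α β n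

def Lfun (h : H) (f : NN α β) : NN α β
  | 0 => 0
  | 1 => pmk α β 0 (α (f 0) * h : H)
  | n+2 => catR α β n (f (n+1)) h

def ρfun (r : R) (f : NN α β) : NN α β
  | 0 => (f 0 * r : R)
  | n+1 => rβ D n r (f (n+1))

abbrev T0 (α : R →ₐ[K] H) (β : R →ₗ[K] H) : Type u := (Module.End K (NN α β))ᵐᵒᵖ

def Lend (α : R →ₐ[K] H) (β : R →ₗ[K] H) : H →ₗ[K] Module.End K (NN α β) where
  toFun h :=
    { toFun := Lfun h
      map_add' := fun f g => by
        funext n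
        match n with
        | 0 => exact (add_zero _).symm
        | 1 =>
          refine Eq.trans ?_ ((pmk α β 0).map_add _ _)
          refine congrArg (pmk α β 0) ?_
          refine Eq.trans ?_ (add_mul _ _ h)
          rw [← map_add]; rfl
        | n+2 => exact congrFun (congrArg DFunLike.coe ((catR α β n).map_add _ _)) h
      map_smul' := fun c f => by
        funext n
        match n with
        | 0 => exact (smul_zero (A := R) c).symm
        | 1 =>
          refine Eq.trans ?_ ((pmk α β 0).map_smul _ _)
          refine congrArg (pmk α β 0) ?_
          refine Eq.trans ?_ (smul_mul_assoc c (α (f 0)) h)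
          rw [← map_smul]; rfl
        | n+2 => exact congrFun (congrArg DFunLike.coe ((catR α β n).map_smul _ _)) h }
  map_add' a b := by
    ext f n
    match n with
    | 0 => exact (add_zero _).symm
    | 1 =>
      refine Eq.trans ?_ ((pmk α β 0).map_add _ _)
      exact congrArg (pmk α β 0) (mul_add (R := H) _ _ _)
    | n+2 => exact (catR α β n _).map_add _ _
  map_smul' c a := by
    ext f n
    match n with
    | 0 => exact (smul_zero (A := R) c).symm
    | 1 =>
      refine Eq.trans ?_ ((pmk α β 0).map_smul _ _)
      exact congrArg (pmk α β 0) (mul_smul_comm (β := H) _ _ _)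
    | n+2 => exact (catR α β n _).map_smul _ _

def ρend : R →ₗ[K] Module.End K (NN α β) where
  toFun r :=
    { toFun := ρfun D r
      map_add' := fun f g => by
        funext n
        match n with
        | 0 => exact add_mul (R := R) _ _ _
        | n+1 => exact (rβ D n r).map_add _ _
      map_smul' := fun c f => by
        funext n
        match n with
        | 0 => exact smul_mul_assoc (β := R) _ _ _
        | n+1 => exact (rβ D n r).map_smul _ _ }
  map_add' a b := by
    ext f n
    match n with
    | 0 => exact mul_add (R := R) _ _ _
    | n+1 => exact congrFun (congrArg DFunLike.coe ((rβ D n).map_add _ _)) _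
  map_smul' c a := by
    ext f n
    match n with
    | 0 => exact mul_smul_comm (β := R) _ _ _
    | n+1 => exact congrFun (congrArg DFunLike.coe ((rβ D n).map_smul _ _)) _

def ρ0 : R →ₐ[K] T0 α β :=
  AlgHom.ofLinearMap ((MulOpposite.opLinearEquiv K).toLinearMap ∘ₗ ρend D)
    (by
      apply MulOpposite.unop_injective
      ext f n
      match n with
      | 0 => exact mul_one (M := R) _
      | n+1 => exact rβ_one D n _)
    (by
      intro r s
      apply MulOpposite.unop_injective
      ext f n
      match n with
      | 0 => exact (mul_assoc (G := R) _ _ _).symm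
      | n+1 => exact rβ_mul D n r s _)

def L0 : bm α β (ρ0 D) := ⟨(MulOpposite.opLinearEquiv K).toLinearMap ∘ₗ Lend α β, by
  constructor
  · intro r h
    apply MulOpposite.unop_injective
    ext f n
    match n with
    | 0 => rfl
    | 1 =>
      refine congrArg (pmk α β 0) ?_
      refine (mul_assoc _ _ _).symm.trans ?_
      exact congrArg (· * h) (map_mul α _ _).symm
    | n+2 => exact (catR_rβ D n r _ h).symm
  · intro r h
    apply MulOpposite.unop_injective
    ext f n
    match n with
    | 0 => exact (zero_mul (M₀ := R) r).symm
    | 1 =>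
      refine congrArg (pmk α β 0) ?_
      refine (mul_assoc _ _ _).symm.trans ?_
      refine (congrArg (· * h) (D.αβ_comm _ _)).trans ?_
      exact mul_assoc _ _ _
    | n+2 => exact (rβ_catR D n r _ h).symm⟩

/-- the embedding -/
def ι (n : ℕ) : Pp α β n →ₗ[K] T0 α β := pprod (fun _ => L0 D) n

def e0 : NN α β
  | 0 => (1 : R)
  | _+1 => 0

theorem ι_ev (n : ℕ) (t : TP K H (n+1)) :
    (MulOpposite.unop (tprod (fun _ => L0 D) n t)) e0 (n+1) = pmk α β n t := by
  induction n with
  | zero =>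
    have h1 : ∀ t : H, α (1 : R) * t = t := by simp
    exact congrArg (pmk α β 0) (h1 t)
  | succ n ih =>
    induction t using tind with
    | h0 => simp
    | h1 t h =>
      rw [tprod_succ]
      rw [← catR_mk, ← ih]
      rfl
    | h2 x y hx hy =>
      rw [map_add, map_add, ← hx, ← hy]; rfl

theorem ι_inj (n : ℕ) : Function.Injective (ι D n) := by
  cases n with
  | zero =>
    intro a b hab
    have := congrArg (fun t : T0 α β => (MulOpposite.unop t) e0 0) hab
    have h2 : ∀ a : R, (MulOpposite.unop (ι D 0 a)) e0 0 = a := fun a => one_mul a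
    exact (h2 a).symm.trans (this.trans (h2 b))
  | succ n =>
    intro a b hab
    obtain ⟨s, rfl⟩ := pmk_surj n a
    obtain ⟨t, rfl⟩ := pmk_surj n b
    rw [← ι_ev D, ← ι_ev D]
    exact congrArg (fun t : T0 α β => (MulOpposite.unop t) e0 (n+1)) hab

/-- characterization of concatenation through the embedding -/
theorem cat_of_ι {p m q N : ℕ} (hN : N = p+m+q) {X : ℕ → H} {w' : Pp α β m} {Y : ℕ → H}
    {w : Pp α β N} (h : ι D N w = pr (fun j => (L0 D).1 (X j)) p * ι D m w' *
      pr (fun j => (L0 D).1 (Y j)) q) : IsCat p m q N X w' Y w := by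
  obtain ⟨w2, h2⟩ := exists_cat p m q N hN X w' Y
  have : w = w2 := ι_inj D N (h.trans (h2 _ (ρ0 D) (fun _ => L0 D)).symm)
  rwa [this]

end model0

section conv
variable {K H R}
variable {α : R →ₐ[K] H} {β : R →ₗ[K] H} (D : HopfAlgebroid K H R α β)
variable {T : Type u} [Ring T] [Algebra K T] {ρ : R →ₐ[K] T}

def IsPres (x : H) {C : ℕ} (uu vv : Fin C → H) : Prop :=
  pmk α β 1 (∑ c, tmul 0 (uu c) (vv c)) = D.Δ x

theorem tpres (s : TP K H 2) : ∃ (C : ℕ) (uu vv : Fin C → H), s = ∑ c, tmul 0 (uu c) (vv c) := by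
  induction s using tind with
  | h0 => exact ⟨0, fun _ => 0, fun _ => 0, by simp⟩
  | h1 t h => exact ⟨1, fun _ => t, fun _ => h, by simp⟩
  | h2 x y hx hy =>
    obtain ⟨C, u, v, rfl⟩ := hx
    obtain ⟨C', u', v', rfl⟩ := hy
    refine ⟨C + C', Fin.append u u', Fin.append v v', ?_⟩
    rw [Fin.sum_univ_add]
    simp

theorem pres (x : H) : ∃ (C : ℕ) (uu vv : Fin C → H), IsPres D x uu vv := by
  obtain ⟨s, hs⟩ := pmk_surj (α := α) (β := β) 1 (D.Δ x)
  obtain ⟨C, u, v, rfl⟩ := tpres s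
  exact ⟨C, u, v, hs⟩

def fam (φ ψ : bm α β ρ) : ℕ → bm α β ρ
  | 0 => φ
  | _+1 => ψ

def convFun (φ ψ : bm α β ρ) : H →ₗ[K] T := pprod (fam φ ψ) 2 ∘ₗ D.Δ

theorem conv_lift (φ ψ : bm α β ρ) {x : H} {s : TP K H 2} (h : pmk α β 1 s = D.Δ x) :
    convFun D φ ψ x = tprod (fam φ ψ) 1 s := by
  rw [← pprod_mk, h]; rfl

theorem tprod_two (Φ : ℕ → bm α β ρ) (u v : H) :
    tprod Φ 1 (tmul 0 u v) = (Φ 0).1 u * (Φ 1).1 v := tprod_succ Φ 0 u v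

theorem conv_pres (φ ψ : bm α β ρ) {x : H} {C : ℕ} {uu vv : Fin C → H} (h : IsPres D x uu vv) :
    convFun D φ ψ x = ∑ c, φ.1 (uu c) * ψ.1 (vv c) := by
  rw [conv_lift D φ ψ h, map_sum]
  refine Finset.sum_congr rfl fun c _ => ?_
  rw [tprod_two]; rfl

theorem slot20 (h : H) : slotP K H 2 0 h = tmul 0 h 1 := rfl
theorem slot21 (h : H) : slotP K H 2 1 h = tmul 0 1 h := rfl

theorem tmul_mul0 (a b h g : H) :
    tmul (K := K) 0 a h * tmul 0 b g = tmul 0 (a*b : H) (h*g) := tmul_mul 0 _ _ _ _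

theorem pres_left {x : H} {C : ℕ} {uu vv : Fin C → H} (h : IsPres D x uu vv) (r : R) :
    IsPres D (α r * x) (fun c => α r * uu c) vv := by
  have := D.Δ_bimod_left r x _ h
  rw [slot20, Finset.mul_sum] at this
  simp only [tmul_mul0, one_mul] at this
  exact this.symm

theorem pres_right {x : H} {C : ℕ} {uu vv : Fin C → H} (h : IsPres D x uu vv) (r : R) :
    IsPres D (β r * x) uu (fun c => β r * vv c) := by
  have := D.Δ_bimod_right r x _ h
  rw [slot21, Finset.mul_sum] at this
  have h1 : ∀ a b h g : H, tmul (K := K) 0 (1 : TP K H 1) h * tmul 0 b g = tmul 0 b (h*g) :=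
    fun a b h g => by
      have := tmul_mul0 (K := K) 1 b h g
      rw [one_mul] at this
      exact this
  simp only [h1 1] at this
  exact this.symm

theorem conv_mem (φ ψ : bm α β ρ) : convFun D φ ψ ∈ bm α β ρ := by
  constructor
  · intro r x
    obtain ⟨C, u, v, h⟩ := pres D x
    rw [conv_pres D φ ψ h, conv_pres D φ ψ (pres_left D h r), Finset.mul_sum]
    simp only [φ.2.1, mul_assoc]
  · intro r x
    obtain ⟨C, u, v, h⟩ := pres D x
    rw [conv_pres D φ ψ h, conv_pres D φ ψ (pres_right D h r), Finset.sum_mul]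
    simp only [ψ.2.2, mul_assoc]

theorem pres_one : IsPres D 1 (fun _ : Fin 1 => 1) (fun _ => 1) := by
  unfold IsPres
  rw [Fin.sum_univ_one]
  exact D.Δ_one.symm

theorem counitl {x : H} {C : ℕ} {uu vv : Fin C → H} (h : IsPres D x uu vv) :
    ∑ c, α (D.ε (uu c)) * vv c = x := D.counit_left x C uu vv h

theorem counitr {x : H} {C : ℕ} {uu vv : Fin C → H} (h : IsPres D x uu vv) :
    ∑ c, β (D.ε (vv c)) * uu c = x := D.counit_right x C uu vv h

theorem pres_mulα {x : H} {C : ℕ} {uu vv : Fin C → H} (h : IsPres D x uu vv) (r : R) :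
    IsPres D (x * α r) (fun c => uu c * α r) vv := by
  have h1 := pres_left D (pres_one D) r
  unfold IsPres at h1
  rw [Fin.sum_univ_one, mul_one] at h1
  have := D.Δ_mul x (α r) _ _ h h1
  rw [Finset.sum_mul] at this
  simp only [tmul_mul0, mul_one] at this
  exact this.symm

theorem counitlα {x : H} {C : ℕ} {uu vv : Fin C → H} (h : IsPres D x uu vv) (r : R) :
    ∑ c, α (D.ε (uu c * α r)) * vv c = x * α r := counitl D (pres_mulα D h r)

def G0 : TP K H 2 →ₗ[K] H :=
  tlift 0 ((LinearMap.mul K H).flip.compl₁₂ LinearMap.id (β ∘ₗ D.ε))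

theorem G0_tmul (u v : H) : G0 D (tmul 0 u v) = β (D.ε v) * u := by
  exact tlift_tmul _ _ _ _

def G : Pp α β 2 →ₗ[K] H := plift 1 (G0 D) (by
  intro r i x hi
  obtain rfl : i = 0 := by omega
  obtain ⟨C, u, v, rfl⟩ := tpres x
  rw [Finset.mul_sum, map_sum]
  refine Finset.sum_eq_zero fun c _ => ?_
  simp only [rel, relator, sub_mul, map_sub]
  have e1 : slotP K H (1+1) 0 (β r) * tmul 0 (u c) (v c) = tmul 0 (β r * u c : H) (1 * v c) :=
    tmul_mul0 _ _ _ _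
  have e2 : slotP K H (1+1) (0+1) (α r) * tmul 0 (u c) (v c) = tmul 0 (1 * u c : H) (α r * v c) :=
    tmul_mul0 _ _ _ _
  rw [e1, e2, G0_tmul, G0_tmul, one_mul, one_mul, D.ε_bimod_left, D.β_mul, mul_assoc, sub_self])

theorem G_mk (s : TP K H 2) : G D (pmk α β 1 s) = G0 D s := rfl

theorem counitrα {x : H} {C : ℕ} {uu vv : Fin C → H} (h : IsPres D x uu vv) (r : R) :
    ∑ c, β (D.ε (vv c * α r)) * uu c = x * β r := by
  have h1 := D.Δ_compat x r _ h
  simp only [relator, mul_sub, map_sub] at h1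
  have h2 := sub_eq_zero.1 h1
  rw [slot20, slot21, Finset.sum_mul, Finset.sum_mul] at h2
  have e2 : ∀ a b : H, tmul (K := K) 0 a b * tmul 0 (1 : TP K H 1) (α r)
      = tmul 0 (a * 1 : H) (b * α r) := fun a b => tmul_mul0 _ _ _ _
  simp only [tmul_mul0, e2, mul_one] at h2
  have h3 := congrArg (G D) h2
  have h4 : ∀ s : TP K H 2, G D (qtMk K H (fun a => α a) (fun a => β a) 2 s) = G0 D s :=
    fun s => rfl
  rw [h4, h4, map_sum, map_sum] at h3
  simp only [G0_tmul] at h3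
  rw [← h3]
  simp only [← mul_assoc]
  rw [← Finset.sum_mul, counitr D h]

def fam3 (φ ψ χ : bm α β ρ) : ℕ → bm α β ρ
  | 0 => φ
  | 1 => ψ
  | _+2 => χ

theorem conv_assoc (φ ψ χ : bm α β ρ) :
    convFun D ⟨convFun D φ ψ, conv_mem D φ ψ⟩ χ = convFun D φ ⟨convFun D ψ χ, conv_mem D ψ χ⟩ := by
  ext x
  obtain ⟨C, u, v, h⟩ := pres D x
  choose s hs using fun c => pmk_surj (α := α) (β := β) 1 (D.Δ (u c))
  choose t ht using fun c => pmk_surj (α := α) (β := β) 1 (D.Δ (v c))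
  have key := D.coassoc x C u v h s t hs ht
  rw [conv_pres D _ _ h, conv_pres D _ _ h]
  have key2 := congrArg (pprod (fam3 φ ψ χ) 3) key
  have e1 : pprod (fam3 φ ψ χ) 3 (qtMk K H (fun a => α a) (fun a => β a) 3
      (∑ c, (s c ⊗ₜ[K] v c : TP K H 3))) = ∑ c, convFun D φ ψ (u c) * χ.1 (v c) := by
    change tprod (fam3 φ ψ χ) 2 (∑ c, tmul 1 (s c) (v c)) = _
    rw [map_sum]
    refine Finset.sum_congr rfl fun c _ => ?_
    rw [tprod_succ, conv_lift D _ _ (hs c)]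
    rfl
  have e2 : pprod (fam3 φ ψ χ) 3 (qtMk K H (fun a => α a) (fun a => β a) 3
      (∑ c, (TensorProduct.assoc K H H H).symm (u c ⊗ₜ[K] t c)))
        = ∑ c, φ.1 (u c) * convFun D ψ χ (v c) := by
    change tprod (fam3 φ ψ χ) 2 (∑ c, (TensorProduct.assoc K H H H).symm (u c ⊗ₜ[K] t c)) = _
    refine (map_sum (tprod (fam3 φ ψ χ) 2) _ _).trans ?_
    refine Finset.sum_congr rfl fun c _ => ?_
    rw [conv_lift D _ _ (ht c)]
    obtain ⟨C', a, b, e⟩ := tpres (t c)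
    rw [e, map_sum, Finset.mul_sum]
    have e3 : ((TensorProduct.assoc K H H H).symm (u c ⊗ₜ[K] (∑ i, tmul 0 (a i) (b i) : TP K H 2)) :
        TP K H 3) = ∑ i, tmul 1 (tmul 0 (u c) (a i)) (b i) := by
      have e4 : u c ⊗ₜ[K] (∑ i, tmul 0 (a i) (b i) : TP K H 2) =
          ∑ i, u c ⊗ₜ[K] (a i ⊗ₜ[K] b i) := TensorProduct.tmul_sum _ _ _
      refine (congrArg _ e4).trans ?_
      refine (map_sum _ _ _).trans ?_
      rfl
    refine (congrArg (tprod (fam3 φ ψ χ) 2) e3).trans ?_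
    rw [map_sum]
    refine Finset.sum_congr rfl fun i _ => ?_
    rw [tprod_succ, tprod_two, tprod_two, mul_assoc]
    rfl
  rw [← e1, ← e2, key2]

/-- convolution algebra -/
def Conv (_ : HopfAlgebroid K H R α β) (ρ : R →ₐ[K] T) : Type u := ↥(bm α β ρ)

instance : AddCommGroup (Conv D ρ) := inferInstanceAs (AddCommGroup ↥(bm α β ρ))
instance : Module K (Conv D ρ) := inferInstanceAs (Module K ↥(bm α β ρ))

def cev (φ : Conv D ρ) : H →ₗ[K] T := φ.1

theorem cext {φ ψ : Conv D ρ} (h : ∀ x, cev D φ x = cev D ψ x) : φ = ψ :=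
  Subtype.ext (LinearMap.ext h)

def convOne (r : R) : Conv D ρ :=
  ⟨ρ.toLinearMap ∘ₗ D.ε ∘ₗ LinearMap.mulRight K (α r), by
    constructor
    · intro s h
      simp [mul_assoc, D.ε_bimod_left]
    · intro s h
      simp [mul_assoc, D.ε_bimod_right]⟩

theorem cev_convOne (r : R) (x : H) : cev D (convOne D r : Conv D ρ) x = ρ (D.ε (x * α r)) := rfl

def convMul (φ ψ : Conv D ρ) : Conv D ρ := ⟨convFun D φ ψ, conv_mem D φ ψ⟩

theorem cev_convMul (φ ψ : Conv D ρ) {x : H} {C : ℕ} {uu vv : Fin C → H} (h : IsPres D x uu vv) :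
    cev D (convMul D φ ψ) x = ∑ c, cev D φ (uu c) * cev D ψ (vv c) := conv_pres D φ ψ h

theorem cev_add (φ ψ : Conv D ρ) (x : H) : cev D (φ + ψ) x = cev D φ x + cev D ψ x := rfl
theorem cev_zero (x : H) : cev D (0 : Conv D ρ) x = 0 := rfl
theorem cev_smul (k : K) (φ : Conv D ρ) (x : H) : cev D (k • φ) x = k • cev D φ x := rfl
theorem cev_left (φ : Conv D ρ) (r : R) (x : H) : cev D φ (α r * x) = ρ r * cev D φ x := φ.2.1 r x
theorem cev_right (φ : Conv D ρ) (r : R) (x : H) : cev D φ (β r * x) = cev D φ x * ρ r := φ.2.2 r x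

theorem convOne_mul (r : R) (φ : Conv D ρ) (x : H) :
    cev D (convMul D (convOne D r) φ) x = cev D φ (x * α r) := by
  obtain ⟨C, u, v, h⟩ := pres D x
  rw [cev_convMul D _ _ h, ← counitlα D h r, map_sum]
  simp only [cev_left, cev_convOne]

theorem mul_convOne (r : R) (φ : Conv D ρ) (x : H) :
    cev D (convMul D φ (convOne D r)) x = cev D φ (x * β r) := by
  obtain ⟨C, u, v, h⟩ := pres D x
  rw [cev_convMul D _ _ h, ← counitrα D h r, map_sum]
  simp only [cev_right, cev_convOne]

instance : Ring (Conv D ρ) :=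
  { (inferInstance : AddCommGroup (Conv D ρ)) with
    mul := convMul D
    one := convOne D 1
    mul_assoc := fun a b c => Subtype.ext (conv_assoc D a b c)
    one_mul := fun a => cext D fun x => by
      refine (convOne_mul D 1 a x).trans ?_
      rw [map_one, mul_one]
    mul_one := fun a => cext D fun x => by
      refine (mul_convOne D 1 a x).trans ?_
      rw [D.β_one, mul_one]
    left_distrib := fun a b c => cext D fun x => by
      obtain ⟨C, u, v, h⟩ := pres D x
      refine (cev_convMul D a (b + c) h).trans (Eq.trans ?_ (congrArg₂ (· + ·)
        (cev_convMul D a b h) (cev_convMul D a c h)).symm)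
      simp only [cev_add, mul_add, Finset.sum_add_distrib]
    right_distrib := fun a b c => cext D fun x => by
      obtain ⟨C, u, v, h⟩ := pres D x
      refine (cev_convMul D (a + b) c h).trans (Eq.trans ?_ (congrArg₂ (· + ·)
        (cev_convMul D a c h) (cev_convMul D b c h)).symm)
      simp only [cev_add, add_mul, Finset.sum_add_distrib]
    zero_mul := fun a => cext D fun x => by
      obtain ⟨C, u, v, h⟩ := pres D x
      refine (cev_convMul D 0 a h).trans ?_
      simp only [cev_zero, zero_mul, Finset.sum_const_zero]
    mul_zero := fun a => cext D fun x => by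
      obtain ⟨C, u, v, h⟩ := pres D x
      refine (cev_convMul D a 0 h).trans ?_
      simp only [cev_zero, mul_zero, Finset.sum_const_zero] }

theorem cev_mul (φ ψ : Conv D ρ) {x : H} {C : ℕ} {uu vv : Fin C → H} (h : IsPres D x uu vv) :
    cev D (φ * ψ) x = ∑ c, cev D φ (uu c) * cev D ψ (vv c) := conv_pres D φ ψ h

instance : Algebra K (Conv D ρ) := Algebra.ofModule
  (fun k a b => cext D fun x => by
    obtain ⟨C, u, v, h⟩ := pres D x
    rw [cev_mul D _ _ h, cev_smul, cev_mul D _ _ h, Finset.smul_sum]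
    simp only [cev_smul, smul_mul_assoc])
  (fun k a b => cext D fun x => by
    obtain ⟨C, u, v, h⟩ := pres D x
    rw [cev_mul D _ _ h, cev_smul, cev_mul D _ _ h, Finset.smul_sum]
    simp only [cev_smul, mul_smul_comm])

def ρC (ρ : R →ₐ[K] T) : R →ₐ[K] Conv D ρ :=
  AlgHom.ofLinearMap
    { toFun := convOne D
      map_add' := fun a b => cext D fun x => by
        simp only [cev_add, cev_convOne, map_add, mul_add]
      map_smul' := fun k b => cext D fun x => by
        rw [RingHom.id_apply]
        simp only [cev_smul, cev_convOne, map_smul, mul_smul_comm] }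
    rfl
    (fun r s => cext D fun x => by
      refine Eq.trans ?_ (convOne_mul D r (convOne D s) x).symm
      simp only [cev_convOne, LinearMap.coe_mk, AddHom.coe_mk, map_mul, mul_assoc])

theorem cev_ρC (r : R) (x : H) : cev D (ρC D ρ r) x = ρ (D.ε (x * α r)) := rfl

def cevL (x : H) : Conv D ρ →ₗ[K] T where
  toFun φ := cev D φ x
  map_add' _ _ := rfl
  map_smul' _ _ := rfl

def shiftC (φ : bm α β ρ) (y : H) : Conv D ρ := ⟨φ.1 ∘ₗ LinearMap.mulRight K y, by
  constructor
  · intro r h; simp [mul_assoc, φ.2.1]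
  · intro r h; simp [mul_assoc, φ.2.2]⟩

theorem cev_shiftC (φ : bm α β ρ) (y x : H) : cev D (shiftC D φ y) x = φ.1 (x * y) := rfl

def hat (φ : bm α β ρ) : bm α β (ρC D ρ) :=
  ⟨{ toFun := shiftC D φ
     map_add' := fun a b => cext D fun x => by simp only [cev_add, cev_shiftC, mul_add, map_add]
     map_smul' := fun a b => cext D fun x => by
      rw [RingHom.id_apply]
      simp only [cev_smul, cev_shiftC, mul_smul_comm, map_smul] },
   by
    constructor
    · intro r y
      refine cext D fun x => ?_
      refine Eq.trans ?_ (convOne_mul D r (shiftC D φ y) x).symm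
      simp only [cev_shiftC, LinearMap.coe_mk, AddHom.coe_mk, mul_assoc]
    · intro r y
      refine cext D fun x => ?_
      refine Eq.trans ?_ (mul_convOne D r (shiftC D φ y) x).symm
      simp only [cev_shiftC, LinearMap.coe_mk, AddHom.coe_mk, mul_assoc]⟩

theorem cev_hat (φ : bm α β ρ) (y x : H) : cev D ((hat D φ).1 y) x = φ.1 (x * y) := rfl

end conv

section action
variable {K H R}
variable {α : R →ₐ[K] H} {β : R →ₗ[K] H} (D : HopfAlgebroid K H R α β)
variable {T : Type u} [Ring T] [Algebra K T] {ρ : R →ₐ[K] T}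

theorem tprod_congr (Φ : ℕ → bm α β ρ) {n : ℕ} {s t : TP K H (n+1)}
    (h : pmk α β n s = pmk α β n t) : tprod Φ n s = tprod Φ n t := by
  rw [← pprod_mk, h, pprod_mk]

theorem cev_sum {C : ℕ} (f : Fin C → Conv D ρ) (x : H) :
    cev D (∑ c, f c) x = ∑ c, cev D (f c) x := map_sum (cevL D x) f Finset.univ

theorem key (Φ : ℕ → bm α β ρ) (m : ℕ) : ∀ (x : H) (s t : TP K H (m+1)),
    pmk α β m s = D.Δpow m x →
    cev D (tprod (fun j => hat D (Φ j)) m t) x = tprod Φ m (s * t) := by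
  induction m with
  | zero =>
    intro x s t h
    rw [tprod_congr Φ (pmk_mul (h.trans (D.Δpow_zero x)) t)]
    rfl
  | succ m ih =>
    intro x s t h
    induction t using tind with
    | h0 => simp [cev_zero]
    | h1 t y =>
      obtain ⟨C, u, v, hx⟩ := pres D x
      choose s' hs' using fun c => pmk_surj (α := α) (β := β) m (D.Δpow m (u c))
      have h2 := h.trans (D.Δpow_succ m x C u v hx s' hs')
      have h3 : pmk α β (m+1) s = pmk α β (m+1) (∑ c, tmul m (s' c) (v c)) := h2
      rw [tprod_congr Φ (pmk_mul h3 _), tprod_succ, cev_mul D _ _ hx, Finset.sum_mul, map_sum]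
      refine Finset.sum_congr rfl fun c _ => ?_
      rw [ih (u c) (s' c) t (hs' c), cev_hat, tmul_mul, tprod_succ]
    | h2 a b ha hb => rw [map_add, cev_add, ha, hb, mul_add, map_add]

theorem cev_mul_mul (φ ψ : Conv D ρ) {x y : H} {C C' : ℕ} {u v : Fin C → H} {a b : Fin C' → H}
    (hx : IsPres D x u v) (hy : IsPres D y a b) : cev D (φ * ψ) (x * y) =
      ∑ d, ∑ c, cev D φ (u c * a d) * cev D ψ (v c * b d) := by
  have := D.Δ_mul x y _ _ hx hy
  refine (conv_lift D φ ψ this.symm).trans ?_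
  rw [Finset.mul_sum, map_sum]
  refine Finset.sum_congr rfl fun d _ => ?_
  rw [Finset.sum_mul, map_sum]
  refine Finset.sum_congr rfl fun c _ => ?_
  rw [tmul_mul0, tprod_two]
  rfl

theorem keyA (Φ : ℕ → bm α β ρ) (m : ℕ) : ∀ (x y : H) (s t : TP K H (m+1)),
    pmk α β m s = D.Δpow m y →
    cev D (tprod (fun j => hat D (Φ j)) m t) (x * y) =
      cev D (tprod (fun j => hat D (Φ j)) m (s * t)) x := by
  induction m with
  | zero =>
    intro x y s t h
    rw [tprod_congr (fun j => hat D (Φ j)) (pmk_mul (h.trans (D.Δpow_zero y)) t)]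
    exact congrArg (Φ 0).1 (mul_assoc (G := H) x y t)
  | succ m ih =>
    intro x y s t h
    induction t using tind with
    | h0 => simp [cev_zero]
    | h1 t z =>
      obtain ⟨C, u, v, hx⟩ := pres D x
      obtain ⟨C', a, b, hy⟩ := pres D y
      choose s' hs' using fun c => pmk_surj (α := α) (β := β) m (D.Δpow m (a c))
      have h2 := h.trans (D.Δpow_succ m y C' a b hy s' hs')
      have h3 : pmk α β (m+1) s = pmk α β (m+1) (∑ c, tmul m (s' c) (b c)) := h2
      rw [tprod_congr _ (pmk_mul h3 _), tprod_succ, cev_mul_mul D _ _ hx hy, Finset.sum_mul,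
        map_sum, cev_sum]
      refine Finset.sum_congr rfl fun d _ => ?_
      rw [tmul_mul, tprod_succ, cev_mul D _ _ hx]
      refine Finset.sum_congr rfl fun c _ => ?_
      rw [ih (u c) (a d) (s' d) t (hs' d), cev_hat, cev_hat, mul_assoc]
    | h2 p q hp hq => rw [map_add, cev_add, hp, hq, mul_add, map_add, cev_add]

def IsAct {m : ℕ} (y : H) (v w : Pp α β m) : Prop :=
  ∀ (T : Type u) [Ring T] [Algebra K T] (ρ : R →ₐ[K] T) (Φ : ℕ → bm α β ρ),
    pprod Φ m w = cev D (pprod (fun j => hat D (Φ j)) m v) y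

theorem ε_assoc (x y : H) : D.ε (x * y) = D.ε (x * α (D.ε y)) := by
  have h := D.ker_ε_ideal x (y - α (D.ε y)) (by
    have := D.ε_bimod_left (D.ε y) 1
    rw [mul_one, D.ε_one, mul_one] at this
    rw [map_sub, this, sub_self])
  rw [mul_sub, map_sub] at h
  exact sub_eq_zero.1 h

theorem isAct_mk {m : ℕ} {y : H} {s t : TP K H (m+1)} (h : pmk α β m s = D.Δpow m y) :
    IsAct D (m := m+1) y (pmk α β m t) (pmk α β m (s * t)) := fun T _ _ ρ Φ => by
  rw [pprod_mk, pprod_mk]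
  exact (key D Φ m y s t h).symm

theorem isAct_zero (y : H) (a : R) : IsAct D (m := 0) y a (D.ε (y * α a) : R) :=
  fun T _ _ ρ Φ => rfl

theorem exists_act {m : ℕ} (y : H) (v : Pp α β m) : ∃ w, IsAct D y v w ∧
    ∀ (T : Type u) [Ring T] [Algebra K T] (ρ : R →ₐ[K] T) (Φ : ℕ → bm α β ρ) (x : H),
      cev D (pprod (fun j => hat D (Φ j)) m v) (x * y) =
        cev D (pprod (fun j => hat D (Φ j)) m w) x := by
  cases m with
  | zero =>
    refine ⟨(D.ε (y * α v) : R), isAct_zero D y v, fun T _ _ ρ Φ x => ?_⟩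
    rw [pprod_zero, pprod_zero, cev_ρC, cev_ρC, mul_assoc, ε_assoc D x]
  | succ m =>
    obtain ⟨t, rfl⟩ := pmk_surj m v
    obtain ⟨s, hs⟩ := pmk_surj (α := α) (β := β) m (D.Δpow m y)
    refine ⟨_, isAct_mk D hs, fun T _ _ ρ Φ x => ?_⟩
    rw [pprod_mk, pprod_mk]
    exact keyA D Φ m x y s t hs

theorem isAct_mul {m : ℕ} {y : H} {v w : Pp α β m} (h : IsAct D y v w)
    (Φ : ℕ → bm α β ρ) (x : H) :
    cev D (pprod (fun j => hat D (Φ j)) m v) (x * y) =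
        cev D (pprod (fun j => hat D (Φ j)) m w) x := by
  obtain ⟨w', h1, h2⟩ := exists_act D y v
  have : w = w' := ι_inj D m ((h _ (ρ0 D) (fun _ => L0 D)).trans (h1 _ _ _).symm)
  rw [this]
  exact h2 T ρ Φ x

theorem Δpow_one_elt (m : ℕ) : D.Δpow m 1 = pmk α β m 1 := by
  induction m with
  | zero => exact D.Δpow_zero 1
  | succ m ih =>
    have := D.Δpow_succ m 1 1 _ _ (pres_one D) (fun _ => 1) (fun c => ih.symm)
    refine this.trans ?_
    exact congrArg (pmk α β (m+1)) (Fin.sum_univ_one _)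

theorem isAct_one {m : ℕ} (v : Pp α β m) : IsAct D 1 v v := by
  cases m with
  | zero =>
    have := isAct_zero D 1 v
    rwa [one_mul, show D.ε (α v) = v by
      have := D.ε_bimod_left v 1
      rwa [mul_one, D.ε_one, mul_one] at this] at this
  | succ m =>
    obtain ⟨t, rfl⟩ := pmk_surj m v
    have := isAct_mk D (t := t) (Δpow_one_elt D m).symm
    rwa [one_mul] at this

/-- insertion family -/
def insF (i : ℕ) (φ : bm α β (ρ0 D)) : ℕ → bm α β (ρ0 D) := fun j => if j = i then φ else L0 D

def Θ (m : ℕ) : Pp α β m →ₗ[K] Conv D (ρ0 D) := pprod (fun _ => hat D (L0 D)) m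

def toC (φ : Conv D (ρ0 D)) : bm α β (ρ0 D) := φ

theorem ins_word (i n : ℕ) (hi : i < n) (φ : bm α β (ρ0 D)) (X : ℕ → H) :
    pprod (insF D i φ) n (word α β n X) = pr (fun j => (L0 D).1 (X j)) i * φ.1 (X i) *
      pr (fun j => (L0 D).1 (X (i+1+j))) (n-(i+1)) := by
  rw [pprod_word, pr_split _ _ _ hi]
  simp only [insF, if_true]
  congr 1
  · congr 1
    apply pr_congr
    intro j hj
    rw [if_neg (by omega)]
  · apply pr_congr
    intro j hj
    rw [if_neg (by omega)]

theorem ins_add (i n : ℕ) (hi : i < n+1) (φ ψ : Conv D (ρ0 D)) (h : Pp α β (n+1)) :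
    pprod (insF D i (toC D (φ + ψ))) (n+1) h = pprod (insF D i (toC D φ)) (n+1) h
      + pprod (insF D i (toC D ψ)) (n+1) h := by
  induction h using word_ind with
  | h0 => simp
  | h1 X =>
    rw [ins_word D _ _ hi, ins_word D _ _ hi, ins_word D _ _ hi, ← add_mul, ← mul_add]
    rfl
  | h2 x y hx hy => rw [map_add, hx, hy, map_add, map_add]; abel

theorem ins_smul (i n : ℕ) (hi : i < n+1) (k : K) (φ : Conv D (ρ0 D)) (h : Pp α β (n+1)) :
    pprod (insF D i (toC D (k • φ))) (n+1) h = k • pprod (insF D i (toC D φ)) (n+1) h := by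
  induction h using word_ind with
  | h0 => simp
  | h1 X =>
    rw [ins_word D _ _ hi, ins_word D _ _ hi, ← smul_mul_assoc, ← mul_smul_comm]
    rfl
  | h2 x y hx hy => rw [map_add, hx, hy, map_add, smul_add]

theorem exists_comp (n m i : ℕ) (hi : i < n+1) (h : Pp α β (n+1)) (u : Pp α β m) :
    ∃ w : Pp α β (n+m), ι D (n+m) w = pprod (insF D i (toC D (Θ D m u))) (n+1) h := by
  induction h using word_ind with
  | h0 => exact ⟨0, by simp⟩
  | h1 X =>
    obtain ⟨a, ha, -⟩ := exists_act D (X i) u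
    obtain ⟨w, hw⟩ := exists_cat i m (n-i) (n+m) (by omega) X a (fun j => X (i+1+j))
    refine ⟨w, ?_⟩
    rw [ins_word D _ _ hi]
    refine (hw _ (ρ0 D) (fun _ => L0 D)).trans ?_
    rw [ha]
    simp only [show n + 1 - (i+1) = n - i by omega]
    rfl
  | h2 x y hx hy =>
    obtain ⟨a, ha⟩ := hx
    obtain ⟨b, hb⟩ := hy
    exact ⟨a + b, by rw [map_add, map_add, ha, hb]⟩

def compF (n m : ℕ) (i : Fin (n+1)) (h : Pp α β (n+1)) (u : Pp α β m) : Pp α β (n+m) :=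
  (exists_comp D n m i i.2 h u).choose

theorem compF_spec (n m : ℕ) (i : Fin (n+1)) (h : Pp α β (n+1)) (u : Pp α β m) :
    ι D (n+m) (compF D n m i h u) = pprod (insF D i (toC D (Θ D m u))) (n+1) h :=
  (exists_comp D n m i i.2 h u).choose_spec

def comp (n m : ℕ) (i : Fin (n+1)) : Pp α β (n+1) →ₗ[K] Pp α β m →ₗ[K] Pp α β (n+m) :=
  LinearMap.mk₂ K (compF D n m i)
    (fun a b u => ι_inj D _ (by rw [map_add]; simp only [compF_spec, map_add]))
    (fun k a u => ι_inj D _ (by rw [map_smul]; simp only [compF_spec, map_smul]))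
    (fun a u v => ι_inj D _ (by
      rw [map_add]; simp only [compF_spec]; rw [map_add, ins_add D _ _ i.2]))
    (fun k a u => ι_inj D _ (by
      rw [map_smul]; simp only [compF_spec]; rw [map_smul, ins_smul D _ _ i.2]))

theorem comp_spec (n m : ℕ) (i : Fin (n+1)) (h : Pp α β (n+1)) (u : Pp α β m) :
    ι D (n+m) (comp D n m i h u) = pprod (insF D i (toC D (Θ D m u))) (n+1) h :=
  compF_spec D n m i h u

theorem ι_word (n : ℕ) (X : ℕ → H) : ι D n (word α β n X) = pr (fun j => (L0 D).1 (X j)) n :=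
  pprod_word _ _ _

theorem ι_act {m : ℕ} {y : H} {v w : Pp α β m} (h : IsAct D y v w) :
    ι D m w = cev D (Θ D m v) y := h _ (ρ0 D) _

theorem ι_comp_word (n m : ℕ) (i : Fin (n+1)) (X : ℕ → H) (u a : Pp α β m)
    (ha : IsAct D (X i) u a) :
    ι D (n+m) (comp D n m i (word α β (n+1) X) u) = pr (fun j => (L0 D).1 (X j)) i * ι D m a *
      pr (fun j => (L0 D).1 (X (i+1+j))) (n-i) := by
  rw [comp_spec, ins_word D _ _ i.2, ι_act D ha, show n + 1 - ((i:ℕ)+1) = n - i by omega]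
  rfl

theorem comp_cat (n m : ℕ) (i : Fin (n+1)) (X : ℕ → H) (u a : Pp α β m)
    (ha : IsAct D (X i) u a) :
    IsCat i m (n-i) (n+m) X a (fun j => X (i+1+j)) (comp D n m i (word α β (n+1) X) u) :=
  cat_of_ι D (by omega) (ι_comp_word D n m i X u a ha)

theorem ι_cast {a b : ℕ} (h : a = b) (x : Pp α β a) :
    ι D b (phCast K H (fun a => α a) (fun a => β a) h x) = ι D a x := by
  subst h; rfl

theorem pprod_cast {a b : ℕ} (h : a = b) (Φ : ℕ → bm α β ρ) (x : Pp α β a) :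
    pprod Φ b (phCast K H (fun a => α a) (fun a => β a) h x) = pprod Φ a x := by
  subst h; rfl

theorem phCast_lin {a b : ℕ} (h : a = b) (x y : Pp α β a) :
    phCast K H (fun a => α a) (fun a => β a) h (x + y) =
    phCast K H (fun a => α a) (fun a => β a) h x + phCast K H (fun a => α a) (fun a => β a) h y := by
  subst h; rfl

/-- compatibility of the action with partial compositions -/
theorem act_comp (m l : ℕ) (j : Fin (m+1)) (u : Pp α β (m+1)) (v : Pp α β l) :
    pprod (fun k => hat D (insF D j (toC D (Θ D l v)) k)) (m+1) u =
      Θ D (m+l) (comp D m l j u v) := by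
  induction u using word_ind with
  | h0 => simp
  | h1 Y =>
    obtain ⟨b, hb, -⟩ := exists_act D (Y j) v
    refine Eq.trans ?_ (comp_cat D m l j Y v b hb _ (ρC D (ρ0 D)) (fun _ => hat D (L0 D))).symm
    rw [pprod_word, pr_split _ _ _ j.2]
    simp only [insF, if_true]
    congr 1
    · congr 1
      · apply pr_congr
        intro k hk
        rw [if_neg (by omega)]
      · refine cext D fun x => ?_
        exact isAct_mul D hb (fun _ => L0 D) x
    · rw [show m + 1 - ((j:ℕ)+1) = m - j by omega]
      apply pr_congr
      intro k hk
      rw [if_neg (by omega)]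
  | h2 x y hx hy => rw [map_add, hx, hy, map_add, LinearMap.add_apply, map_add]

theorem seq_ax (n m l : ℕ) (i : Fin (n+1)) (j : Fin (m+1)) (h : Pp α β (n+1)) (u : Pp α β (m+1))
    (v : Pp α β l) (hij : (i:ℕ)+j < n+m+1) :
    ι D (n+m+l) (comp D (n+m) l ⟨(i:ℕ)+j, hij⟩ (comp D n (m+1) i h u) v) =
      ι D (n+(m+l)) (comp D n (m+l) i h (comp D m l j u v)) := by
  rw [comp_spec]
  induction h using word_ind with
  | h0 => simp
  | h1 X =>
    obtain ⟨a, ha, -⟩ := exists_act D (X i) u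
    obtain ⟨a', ha', -⟩ := exists_act D (X i) (comp D m l j u v)
    rw [ι_comp_word D n (m+l) i X _ a' ha', ι_act D ha', ← act_comp]
    refine (comp_cat D n (m+1) i X u a ha _ _ _).trans ?_
    congr 1
    · congr 1
      · apply pr_congr
        intro k hk
        rw [insF, if_neg (by simp only; omega)]
      · rw [ha]
        have : (fun k => hat D (insF D ((i:ℕ)+j) (toC D (Θ D l v)) (i+k))) =
            (fun k => hat D (insF D j (toC D (Θ D l v)) k)) := by
          funext k
          simp only [insF, Nat.add_left_cancel_iff]
        rw [← this]
    · apply pr_congr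
      intro k hk
      rw [insF, if_neg (by simp only; omega)]
  | h2 x y hx hy =>
    simp only [map_add, LinearMap.add_apply] at hx hy ⊢
    rw [← hx, ← hy]

theorem pprod_congr {Φ Ψ : ℕ → bm α β ρ} {n : ℕ} (h : ∀ j < n, Φ j = Ψ j) (x : Pp α β n) :
    pprod Φ n x = pprod Ψ n x := by
  cases n with
  | zero => rfl
  | succ n =>
    induction x using word_ind with
    | h0 => simp
    | h1 X =>
      rw [pprod_word, pprod_word]
      exact pr_congr fun j hj => by rw [h j hj]
    | h2 x y hx hy => rw [map_add, hx, hy, map_add]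

theorem mul_five {T : Type u} [Ring T] {A A' a a' B B' c c' d d' : T} (h1 : A = A') (h2 : a = a')
    (h3 : B = B') (h4 : c = c') (h5 : d = d') : A * a * (B * c * d) = A' * a' * B' * c' * d' := by
  subst h1 h2 h3 h4 h5; simp only [mul_assoc]

theorem par_ax (n m l i k : ℕ) (hik : i < k) (hk : k ≤ n+1) (h : Pp α β (n+2))
    (u : Pp α β (m+1)) (v : Pp α β l) (h1 : k + m < n+1+m+1) (h2 : i < n+1+1) (h3 : k < n+1+1)
    (h4 : i < n+l+1) (h5 : n+1+l = n+l+1) :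
    ι D (n+1+m+l) (comp D (n+1+m) l ⟨k+m, h1⟩ (comp D (n+1) (m+1) ⟨i, h2⟩ h u) v) =
      ι D (n+l+(m+1)) (comp D (n+l) (m+1) ⟨i, h4⟩ (phCast K H (fun a => α a) (fun a => β a) h5
        (comp D (n+1) l ⟨k, h3⟩ h v)) u) := by
  rw [comp_spec, comp_spec, pprod_cast]
  induction h using word_ind with
  | h0 => simp
  | h1 X =>
    obtain ⟨a, ha, -⟩ := exists_act D (X i) u
    obtain ⟨b, hb, -⟩ := exists_act D (X k) v
    refine (comp_cat D (n+1) (m+1) ⟨i, h2⟩ X u a ha _ _ _).trans ?_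
    refine Eq.trans ?_ (comp_cat D (n+1) l ⟨k, h3⟩ X v b hb _ _ _).symm
    simp only
    have e1 : pprod (fun j => insF D (k+m) (toC D (Θ D l v)) (i+j)) (m+1) a = ι D (m+1) a := by
      refine pprod_congr (fun j hj => ?_) a
      rw [insF, if_neg (by omega)]
    have e2 : pprod (fun j => insF D i (toC D (Θ D (m+1) u)) (k+j)) l b = ι D l b := by
      have : (fun j => insF D i (toC D (Θ D (m+1) u)) (k+j)) = fun _ => L0 D := by
        funext j
        rw [insF, if_neg (by omega)]
      rw [this]; rfl
    rw [e1, e2, pr_split _ k i hik, pr_split _ (n+1-i) (k-(i+1)) (by omega)]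
    refine mul_five (pr_congr fun j hj => ?_) ?_ (pr_congr fun j hj => ?_) ?_ ?_
    · rw [insF, insF, if_neg (by omega), if_neg (by omega)]
    · rw [insF, if_pos rfl, ι_act D ha]; rfl
    · rw [insF, insF, if_neg (by omega), if_neg (by omega)]
    · rw [insF, if_pos (by omega), ι_act D hb, show i + 1 + (k - (i+1)) = k by omega]; rfl
    · rw [show n + 1 - i - (k - (i+1) + 1) = n + 1 - k by omega]
      refine pr_congr fun j hj => ?_
      rw [insF, insF, if_neg (by omega), if_neg (by omega)]
      rw [show i + 1 + (k - (i+1) + 1 + j) = k + 1 + j by omega]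
  | h2 x y hx hy =>
    simp only [map_add, LinearMap.add_apply] at hx hy ⊢
    rw [← hx, ← hy]

end action

section clauses
variable {K H R}
variable {α : R →ₐ[K] H} {β : R →ₗ[K] H} (D : HopfAlgebroid K H R α β)

def extN {n : ℕ} (x : Fin n → H) : ℕ → H := fun j => if h : j < n then x ⟨j, h⟩ else 0

theorem extN_lt {n : ℕ} (x : Fin n → H) (j : ℕ) (h : j < n) : extN x j = x ⟨j, h⟩ := dif_pos h

theorem mk_word (n : ℕ) (x : Fin (n+1) → H) :
    pmk α β n (chainP K H (n+1) x) = word α β (n+1) (extN x) := by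
  have : x = fun j : Fin (n+1) => extN x j := by
    funext j
    rw [extN_lt x j j.2]
  exact congrArg (fun z => pmk α β n (chainP K H (n+1) z)) this

theorem chain_mul (n : ℕ) (x y : Fin (n+1) → H) :
    chainP K H (n+1) x * chainP K H (n+1) y = chainP K H (n+1) (fun t => x t * y t) := by
  induction n with
  | zero => rw [chain_zero, chain_zero, chain_zero]; rfl
  | succ n ih => rw [chain_succ, chain_succ, chain_succ, tmul_mul, ih]

theorem clause1 (n m : ℕ) (i : Fin (n + 1)) (x : Fin (n + 1) → H) (y : Fin (m + 1) → H)
    (C : ℕ) (z : Fin C → Fin (m + 1) → H)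
    (hz : pmk α β m (∑ c, chainP K H (m + 1) (z c)) = D.Δpow m (x i)) :
    comp D n (m + 1) i (pmk α β n (chainP K H (n + 1) x)) (pmk α β m (chainP K H (m + 1) y)) =
      pmk α β (n + m) (∑ c, chainP K H (n + (m + 1)) (insChain i x (fun t => z c t * y t))) := by
  apply ι_inj D (n+(m+1))
  have hi := extN_lt x i i.2
  rw [← show extN x i = x i from hi] at hz
  rw [mk_word, ι_comp_word D n (m+1) i (extN x) _ _ (isAct_mk D hz), Finset.sum_mul, map_sum,
    map_sum, map_sum, Finset.mul_sum, Finset.sum_mul]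
  refine Eq.trans ?_ (map_sum (ι D (n+(m+1))) _ _).symm
  refine Finset.sum_congr rfl fun c _ => ?_
  rw [chain_mul, mk_word, ι_word]
  refine Eq.trans ?_ ((congrArg (ι D (n+m+1)) (mk_word (n+m) _)).trans (ι_word D (n+m+1) _)).symm
  refine Eq.trans ?_ (congrArg (pr (fun j => (L0 D).1
    (extN (insChain i x fun t => z c t * y t) j))) (show (i:ℕ) + (m+1) + (n-i) = n+m+1 by omega))
  rw [pr_add _ ((i:ℕ)+(m+1)) (n-i), pr_add _ (i:ℕ) (m+1)]
  congr 1
  · congr 1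
    · refine pr_congr fun j hj => ?_
      rw [extN_lt _ j (by omega), extN_lt _ j (by omega), insChain, dif_pos hj]
    · refine pr_congr fun j hj => ?_
      rw [extN_lt _ j (by omega), extN_lt _ (i+j) (by omega), insChain,
        dif_neg (by simp only; omega), dif_pos (by simp only; omega)]
      simp only [Nat.add_sub_cancel_left]
  · refine pr_congr fun j hj => ?_
    rw [extN_lt _ _ (by omega), extN_lt _ (i+(m+1)+j) (by omega), insChain,
        dif_neg (by simp only; omega), dif_neg (by simp only; omega)]
    simp only [show (i:ℕ) + (m+1) + j - m = i + 1 + j by omega]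

theorem clause2 (i : Fin 1) (h : H) (a : R) :
    comp D 0 0 i (pmk α β 0 h) a = (D.hAct h a : R) := by
  apply ι_inj D 0
  obtain rfl : i = 0 := Subsingleton.elim _ _
  exact comp_spec D 0 0 0 (pmk α β 0 h) a

theorem clause3 (n : ℕ) (i : Fin (n + 2)) (x : Fin (n + 2) → H) (a : R) (g : Fin (n+1) → H)
    (hg : ∀ j : Fin (n+1), g j = if (i : ℕ) ≤ n then
                (if (j : ℕ) < (i : ℕ) then extN x j
                 else if (j : ℕ) = (i : ℕ) then
                   α (D.hAct (x i) a) * extN x ((j : ℕ) + 1)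
                 else extN x ((j : ℕ) + 1))
              else
                (if (j : ℕ) + 1 = n + 1 then β (D.hAct (x i) a) * extN x j
                 else extN x j)) :
    comp D (n + 1) 0 i (pmk α β (n+1) (chainP K H (n + 2) x)) a =
      pmk α β n (chainP K H (n + 1) g) := by
  apply ι_inj D (n+1)
  have hi : extN x i = x i := extN_lt x i i.2
  rw [mk_word, ι_comp_word D (n+1) 0 i (extN x) a _ (isAct_zero D _ a), hi, mk_word]
  refine Eq.trans ?_ (ι_word D (n+1) _).symm
  change _ * (ρ0 D) (D.hAct (x i) a) * _ = _
  by_cases hin : (i:ℕ) ≤ n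
  · rw [pr_split _ (n+1) i (by omega), show n + 1 - (i:ℕ) = 1 + (n + 1 - (i+1)) by omega,
      pr_add, pr_one, mul_assoc, ← mul_assoc (ρ0 D _), ← (L0 D).2.1, ← mul_assoc]
    congr 1
    · congr 1
      · refine pr_congr fun j hj => ?_
        rw [extN_lt g j (by omega), hg, if_pos hin, if_pos hj]
      · rw [extN_lt g _ (by omega), hg, if_pos hin, if_neg (by simp), if_pos rfl]
    · refine pr_congr fun j hj => ?_
      rw [extN_lt g _ (by omega), hg, if_pos hin,
        if_neg (by simp only; omega), if_neg (by simp only; omega)]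
      simp only [show (i:ℕ) + 1 + (1 + j) = i + 1 + j + 1 by omega]
  · have hi' : (i:ℕ) = n + 1 := by omega
    rw [hi', Nat.sub_self]
    simp only [pr, mul_one]
    rw [mul_assoc, ← (L0 D).2.2]
    congr 1
    · refine pr_congr fun j hj => ?_
      rw [extN_lt g j (by omega), hg, if_neg (by omega), if_neg (by simp only; omega)]
    · rw [extN_lt g _ (by omega), hg, if_neg (by omega), if_pos rfl]

theorem unit_left (m : ℕ) (i : Fin 1) (u : Pp α β m) :
    ι D (0+m) (comp D 0 m i (pmk α β 0 1) u) = ι D m u := by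
  obtain rfl : i = 0 := Subsingleton.elim _ _
  rw [comp_spec]
  exact (ι_act D (isAct_one D u)).symm

theorem unit_right (n : ℕ) (i : Fin (n + 1)) (x : Pp α β (n+1)) :
    comp D n 1 i x (pmk α β 0 1) = x := by
  apply ι_inj D (n+1)
  rw [comp_spec]
  refine pprod_congr (fun j _ => ?_) x
  rw [insF]
  split_ifs
  · refine Subtype.ext (LinearMap.ext fun y => ?_)
    exact (cev_hat D (L0 D) 1 y).trans (congrArg (L0 D).1 (mul_one y))
  · rfl

end clauses

end HopfOp
/-! ### STATEMENT 1 -/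

/-- **The non-symmetric operad `P_H` associated with a Hopf algebroid (Xu).**
Let `(H, α, β, ·, Δ, ε)` be a Hopf algebroid over `R`.  The family of `K`-vector spaces
`P_H(n) := H^{⊗_R n}` (`n ≥ 0`, with `P_H(0) = R`), together with the composition maps
`γ(h; u₁, …, u_n) = (Δ^{k₁−1}h₁)·u₁ ⊗_R ⋯ ⊗_R (Δ^{k_n−1}h_n)·u_n` and the identity
`1 ∈ H = P_H(1)`, is a non-symmetric operad over `K`: the compositions are well defined
(they exist as bilinear partial composition maps `∘_i`, characterized on sums of pure
tensors by the insertion formula), the unitality axiom holds, and the partial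
compositions satisfy the sequential and parallel composition axioms.
(Below, `comp n m i : P_H(n+1) → P_H(m) → P_H(n+m)` is the partial composition
`h ∘_{i+1} u` in `0`-indexed form.) -/
theorem hopfAlgebroid_operad
    (K : Type u) [Field K] [CharZero K]
    (H : Type u) [Ring H] [Algebra K H]
    (R : Type u) [Ring R] [Algebra K R]
    (α : R →ₐ[K] H) (β : R →ₗ[K] H)
    (D : HopfAlgebroid K H R α β) :
    ∃ comp : ∀ (n m : ℕ), Fin (n + 1) →
        (PH K H (fun a => α a) (fun a => β a) (n + 1) →ₗ[K]
          PH K H (fun a => α a) (fun a => β a) m →ₗ[K]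
          PH K H (fun a => α a) (fun a => β a) (n + m)),
      -- defining formula, insertion of a positive-degree element:
      -- `(x₁ ⊗ ⋯ ⊗ x_{n+1}) ∘_i u = x₁ ⊗ ⋯ ⊗ (Δ^{m}(x_i) · u) ⊗ ⋯ ⊗ x_{n+1}`
      (∀ (n m : ℕ) (i : Fin (n + 1)) (x : Fin (n + 1) → H) (y : Fin (m + 1) → H)
          (C : ℕ) (z : Fin C → Fin (m + 1) → H),
        qtMk K H (fun a => α a) (fun a => β a) (m + 1)
            (∑ c, chainP K H (m + 1) (z c)) = D.Δpow m (x i) →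
        comp n (m + 1) i
            (qtMk K H (fun a => α a) (fun a => β a) (n + 1) (chainP K H (n + 1) x))
            (qtMk K H (fun a => α a) (fun a => β a) (m + 1) (chainP K H (m + 1) y)) =
          qtMk K H (fun a => α a) (fun a => β a) (n + (m + 1))
            (∑ c, chainP K H (n + (m + 1)) (insChain i x (fun t => z c t * y t)))) ∧
      -- defining formula, insertion of a degree-0 element `a ∈ R = P_H(0)`,
      -- base case `n = 0`: `h ∘₁ a = h ▷ a`
      (∀ (i : Fin 1) (h : H) (a : R),
        comp 0 0 i (qtMk K H (fun a => α a) (fun a => β a) 1 h) a = D.hAct h a) ∧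
      -- defining formula, insertion of a degree-0 element, `n ≥ 1`: the slot `i` is
      -- deleted and `x_i ▷ a` acts on the neighbouring slot through `α` resp. `β`
      (∀ (n : ℕ) (i : Fin (n + 2)) (x : Fin (n + 2) → H) (a : R),
        comp (n + 1) 0 i
            (qtMk K H (fun a => α a) (fun a => β a) (n + 2) (chainP K H (n + 2) x)) a =
          qtMk K H (fun a => α a) (fun a => β a) (n + 1)
            (chainP K H (n + 1) (fun j : Fin (n + 1) =>
              if (i : ℕ) ≤ n then
                (if (j : ℕ) < (i : ℕ) then x ⟨(j : ℕ), by omega⟩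
                 else if (j : ℕ) = (i : ℕ) then
                   α (D.hAct (x i) a) * x ⟨(j : ℕ) + 1, by omega⟩
                 else x ⟨(j : ℕ) + 1, by omega⟩)
              else
                (if (j : ℕ) + 1 = n + 1 then β (D.hAct (x i) a) * x ⟨(j : ℕ), by omega⟩
                 else x ⟨(j : ℕ), by omega⟩)))) ∧
      -- left unitality: `id ∘₁ u = u`, where `id = 1 ∈ H^{⊗_R 1}`
      (∀ (m : ℕ) (u : PH K H (fun a => α a) (fun a => β a) m),
        comp 0 m ⟨0, Nat.zero_lt_succ 0⟩
            (qtMk K H (fun a => α a) (fun a => β a) 1 1) u =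
          phCast K H (fun a => α a) (fun a => β a) (by omega) u) ∧
      -- right unitality: `x ∘_i id = x`
      (∀ (n : ℕ) (i : Fin (n + 1)) (x : PH K H (fun a => α a) (fun a => β a) (n + 1)),
        comp n 1 i x (qtMk K H (fun a => α a) (fun a => β a) 1 1) = x) ∧
      -- sequential composition axiom
      (∀ (n m l : ℕ) (i : Fin (n + 1)) (j : Fin (m + 1))
          (h : PH K H (fun a => α a) (fun a => β a) (n + 1))
          (u : PH K H (fun a => α a) (fun a => β a) (m + 1))
          (v : PH K H (fun a => α a) (fun a => β a) l),
        comp (n + m) l ⟨(i : ℕ) + (j : ℕ), by have := i.isLt; have := j.isLt; omega⟩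
            (comp n (m + 1) i h u) v =
          phCast K H (fun a => α a) (fun a => β a) (by omega)
            (comp n (m + l) i h (comp m l j u v))) ∧
      -- parallel composition axiom
      (∀ (n m l : ℕ) (i k : ℕ) (hik : i < k) (hk : k ≤ n + 1)
          (h : PH K H (fun a => α a) (fun a => β a) (n + 2))
          (u : PH K H (fun a => α a) (fun a => β a) (m + 1))
          (v : PH K H (fun a => α a) (fun a => β a) l),
        comp (n + 1 + m) l ⟨k + m, by omega⟩
            (comp (n + 1) (m + 1) ⟨i, by omega⟩ h u) v =
          phCast K H (fun a => α a) (fun a => β a) (by omega)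
            (comp (n + l) (m + 1) ⟨i, by omega⟩
              (phCast K H (fun a => α a) (fun a => β a) (by omega)
                (comp (n + 1) l ⟨k, by omega⟩ h v)) u)) := by
  refine ⟨HopfOp.comp D, ?_, ?_, ?_, ?_, ?_, ?_, ?_⟩
  · intro n m i x y C z hz
    exact HopfOp.clause1 D n m i x y C z hz
  · intro i h a
    exact HopfOp.clause2 D i h a
  · intro n i x a
    exact HopfOp.clause3 D n i x a _ (fun j => by
      have h1 : HopfOp.extN x j = x ⟨(j:ℕ), by omega⟩ := HopfOp.extN_lt x j _
      have h2 : HopfOp.extN x ((j:ℕ)+1) = x ⟨(j:ℕ)+1, by omega⟩ := HopfOp.extN_lt x _ _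
      rw [h1, h2])
  · intro m u
    apply HopfOp.ι_inj D (0+m)
    rw [HopfOp.ι_cast]
    exact HopfOp.unit_left D m _ u
  · intro n i x
    exact HopfOp.unit_right D n i x
  · intro n m l i j h u v
    apply HopfOp.ι_inj D (n+m+l)
    rw [HopfOp.ι_cast]
    exact HopfOp.seq_ax D n m l i j h u v _
  · intro n m l i k hik hk h u v
    apply HopfOp.ι_inj D (n+1+m+l)
    rw [HopfOp.ι_cast]
    exact HopfOp.par_ax D n m l i k hik hk h u v _ _ _ _ _
end
end

section
/- For every non-symmetric operad P over K, the graded K-vector space W_P := ⊕_{n≥0} P(n)[−n], equipped with the operadic brace operations x{y₁,…,y_k}, is a brace algebra: x{} = x for all x, and the higher pre-Jacobi identities hold: x{y₁,…,y_n}{z₁,…,z_m} = Σ (−1)^{Σ_{p=1}^{n}(|y_p|+1)Σ_{q=1}^{i_p}(|z_q|+1)} x{z₁,…,z_{i₁}, y₁{z_{i₁+1},…,z_{i₁+r₁}}, …, z_{i_n}, y_n{z_{i_n+1},…,z_{i_n+r_n}}, …, z_m}, the sum being over all sequences of nonnegative integers with i₁+r₁ ≤ i₂, …, i_{n−1}+r_{n−1}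 ≤ i_n, i_n+r_n ≤ m. -/
/-! # Preliminaries: graded brace algebras and brace `B∞` algebras -/

noncomputable section

open scoped TensorProduct

universe u

namespace BraceCombinatorics

/-- The index set appearing in the higher pre-Jacobi identities: sequences
`i₁, …, i_n`, `r₁, …, r_n` with `i_p + r_p ≤ i_q` for `p < q` and `i_p + r_p ≤ m`. -/
def InsData (n m : ℕ) : Type :=
  {ir : (Fin n → Fin (m + 1)) × (Fin n → Fin (m + 1)) //
    (∀ a b : Fin n, a < b → (ir.1 a : ℕ) + (ir.2 a : ℕ) ≤ (ir.1 b : ℕ)) ∧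
    ∀ a : Fin n, (ir.1 a : ℕ) + (ir.2 a : ℕ) ≤ m}

instance (n m : ℕ) : Fintype (InsData n m) := by
  unfold InsData; infer_instance

/-- The position, in the output list of the pre-Jacobi right-hand side, at which the
`p`-th inner brace `y_p{z_{i_p+1}, …, z_{i_p+r_p}}` is placed. -/
def oPos {n m : ℕ} (ins : InsData n m) (p : Fin n) : ℕ :=
  (ins.1.1 p : ℕ) + (p : ℕ) - ∑ a ∈ Finset.univ.filter (fun a : Fin n => a < p), (ins.1.2 a : ℕ)

/-- The list of arguments `z₁, …, z_{i₁}, y₁{z_{i₁+1},…,z_{i₁+r₁}}, …, z_m` appearing on the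
right-hand side of the higher pre-Jacobi identity. -/
def insArgs {W : Type u} [AddCommGroup W]
    (μf : ∀ k : ℕ, W → (Fin k → W) → W) {n m : ℕ} (ins : InsData n m)
    (y : Fin n → W) (z : Fin m → W) :
    Fin (n + m - ∑ a : Fin n, (ins.1.2 a : ℕ)) → W := fun t =>
  if h : ∃ p : Fin n, oPos ins p = (t : ℕ) then
    μf ((ins.1.2 h.choose : ℕ)) (y h.choose)
      (fun s : Fin ((ins.1.2 h.choose : ℕ)) =>
        z ⟨(ins.1.1 h.choose : ℕ) + (s : ℕ), by
          have h1 := ins.2.2 h.choose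
          have h2 := s.isLt
          omega⟩)
  else
    let idx : ℕ := (t : ℕ)
        - (Finset.univ.filter (fun p : Fin n => oPos ins p < (t : ℕ))).card
        + ∑ p ∈ Finset.univ.filter (fun p : Fin n => oPos ins p < (t : ℕ)), (ins.1.2 p : ℕ)
    if hx : idx < m then z ⟨idx, hx⟩ else 0

/-- The sign exponent `∑_{p=1}^n (|y_p|+1) · ∑_{q=1}^{i_p} (|z_q|+1)` of the pre-Jacobi
identity. -/
def insExp {n m : ℕ} (ins : InsData n m) (e : Fin n → ℤ) (f : Fin m → ℤ) : ℤ :=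
  ∑ p : Fin n, (e p + 1) *
    ∑ q ∈ Finset.univ.filter (fun q : Fin m => (q : ℕ) < (ins.1.1 p : ℕ)), (f q + 1)

end BraceCombinatorics

open BraceCombinatorics

/-- The higher pre-Jacobi identities for a family of brace operations `μf` on a graded
vector space with grading `P`. -/
def IsPreJacobi {K : Type u} [Field K] {W : Type u} [AddCommGroup W] [Module K W]
    (μf : ∀ k : ℕ, W → (Fin k → W) → W) (P : ℤ → Submodule K W) : Prop :=
  ∀ (n m : ℕ) (d : ℤ) (e : Fin n → ℤ) (f : Fin m → ℤ)
    (x : W) (y : Fin n → W) (z : Fin m → W),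
    x ∈ P d → (∀ a, y a ∈ P (e a)) → (∀ b, z b ∈ P (f b)) →
    μf m (μf n x y) z =
      ∑ ins : InsData n m, sgn K (insExp ins e f) • μf _ x (insArgs μf ins y z)

/-- A brace algebra: a `ℤ`-graded `K`-vector space `W` with `K`-multilinear brace
operations `μ k : W ⊗ (W[1])^{⊗k} → W`, `x{x₁,…,x_k} := μ k x (x₁,…,x_k)`, such that
`x{} = x` and the higher pre-Jacobi identities hold. -/
structure BraceAlg (K : Type u) [Field K] (W : Type u) [AddCommGroup W] [Module K W] :
    Type u where
  /-- the grading of `W` -/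
  grading : ℤ → Submodule K W
  /-- `W` is the (internal) direct sum of its homogeneous components -/
  decomp : DirectSum.IsInternal grading
  /-- the brace operations -/
  μ : ∀ k : ℕ, W →ₗ[K] MultilinearMap K (fun _ : Fin k => W) W
  /-- braces are degree-`0` maps `W ⊗ (W[1])^{⊗ k} → W` -/
  μ_grade : ∀ {k : ℕ} (d : ℤ) (e : Fin k → ℤ) (x : W) (y : Fin k → W),
    x ∈ grading d → (∀ i, y i ∈ grading (e i)) →
    μ k x y ∈ grading (d + ∑ i, (e i - 1))
  /-- `x{} = x` -/
  μ_zero : ∀ x : W, μ 0 x ![] = x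
  /-- the higher pre-Jacobi identities -/
  pre_jacobi : IsPreJacobi (fun k x y => μ k x y) grading

/-- A brace `B∞` algebra: a brace algebra together with a degree `+1` differential `d`
and a degree `0` associative product, satisfying the Leibniz rule, the distributivity
relations and the higher homotopy relations. -/
structure BraceBInfty (K : Type u) [Field K] (W : Type u) [AddCommGroup W] [Module K W]
    extends BraceAlg K W where
  /-- the differential -/
  d : W →ₗ[K] W
  /-- the associative product -/
  mul : W →ₗ[K] W →ₗ[K] W
  d_grade : ∀ (a : ℤ) (x : W), x ∈ grading a → d x ∈ grading (a + 1)
  mul_grade : ∀ (a b : ℤ) (x y : W), x ∈ grading a → y ∈ grading b →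
    mul x y ∈ grading (a + b)
  d_sq : ∀ x : W, d (d x) = 0
  mul_assoc' : ∀ x y z : W, mul (mul x y) z = mul x (mul y z)
  leibniz : ∀ (a : ℤ) (x y : W), x ∈ grading a →
    d (mul x y) = mul (d x) y + sgn K a • mul x (d y)
  /-- the distributivity relations -/
  distrib : ∀ (n : ℕ) (b : ℤ) (f : Fin n → ℤ) (x₁ x₂ : W) (y : Fin n → W),
    x₂ ∈ grading b → (∀ i, y i ∈ grading (f i)) →
    μ n (mul x₁ x₂) y =
      ∑ k : Fin (n + 1),
        sgn K (b * ∑ p ∈ Finset.univ.filter (fun p : Fin n => (p : ℕ) < (k : ℕ)), (f p + 1)) •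
          mul (μ (k : ℕ) x₁ (fun i : Fin (k : ℕ) => y (Fin.castLE (Nat.lt_succ_iff.mp k.isLt) i)))
              (μ (n - (k : ℕ)) x₂ (fun i : Fin (n - (k : ℕ)) =>
                y ⟨(k : ℕ) + (i : ℕ), by have := i.isLt; omega⟩))
  /-- the higher homotopies -/
  homotopy : ∀ (n : ℕ) (a : ℤ) (f : Fin (n + 1) → ℤ) (x : W) (xs : Fin (n + 1) → W),
    x ∈ grading a → (∀ i, xs i ∈ grading (f i)) →
    d (μ (n + 1) x xs) - μ (n + 1) (d x) xs
      - ∑ i : Fin (n + 1),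
          sgn K (a + 1 + ∑ j ∈ Finset.univ.filter (fun j : Fin (n + 1) => (j : ℕ) < (i : ℕ)), (f j + 1)) •
            μ (n + 1) x (Function.update xs i (d (xs i)))
    = sgn K (a * (f 0 + 1)) • mul (xs 0) (μ n x (fun i : Fin n => xs i.succ))
      - ∑ i : Fin n,
          sgn K (a + 1 + ∑ j ∈ Finset.univ.filter (fun j : Fin (n + 1) => (j : ℕ) ≤ (i : ℕ)), (f j + 1)) •
            μ n x (fun t : Fin n =>
              if (t : ℕ) < (i : ℕ) then xs t.castSucc
              else if (t : ℕ) = (i : ℕ) then mul (xs t.castSucc) (xs t.succ)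
              else xs t.succ)
      + sgn K (a + 1 + ∑ j ∈ Finset.univ.filter (fun j : Fin (n + 1) => (j : ℕ) < n), (f j + 1)) •
          mul (μ n x (fun i : Fin n => xs i.castSucc)) (xs (Fin.last n))

/-- A strict `B∞` morphism between brace `B∞` algebras: a degree-preserving linear map
commuting with the differentials, the products, and all brace operations. -/
structure IsStrictBInftyHom {K : Type u} [Field K]
    {W₁ : Type u} [AddCommGroup W₁] [Module K W₁]
    {W₂ : Type u} [AddCommGroup W₂] [Module K W₂]
    (B₁ : BraceBInfty K W₁) (B₂ : BraceBInfty K W₂) (F : W₁ →ₗ[K] W₂) : Prop where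
  grade : ∀ (a : ℤ) (x : W₁), x ∈ B₁.grading a → F x ∈ B₂.grading a
  comm_d : ∀ x, F (B₁.d x) = B₂.d (F x)
  comm_mul : ∀ x y, F (B₁.mul x y) = B₂.mul (F x) (F y)
  comm_μ : ∀ (k : ℕ) (x : W₁) (y : Fin k → W₁),
    F (B₁.μ k x y) = B₂.μ k (F x) (fun i => F (y i))

/-! ## Non-symmetric operads -/

/-- A non-symmetric operad over `K`, presented by its total space `A = ⊕ₙ P(n)` with the
grading `P`, the identity element `id_P ∈ P(1)`, and the (bilinear) partial composition
maps `comp i x y = x ∘_{i+1} y` (`0`-indexed), subject to the sequential and parallel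
composition axioms and the unitality axiom. -/
structure NsOperad (K : Type u) [Field K] (A : Type u) [AddCommGroup A] [Module K A] :
    Type u where
  grading : ℕ → Submodule K A
  decomp : DirectSum.IsInternal grading
  /-- the operadic identity. -/
  idp : A
  idp_grade : idp ∈ grading 1
  /-- `comp i x y` is the partial composition `x ∘_{i+1} y` (`0`-indexed slot `i`). -/
  comp : ℕ → A →ₗ[K] A →ₗ[K] A
  comp_grade : ∀ {n m : ℕ} (i : ℕ), i < n → ∀ x ∈ grading n, ∀ y ∈ grading m,
    comp i x y ∈ grading (n + m - 1)
  /-- the sequential composition axiom -/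
  seq : ∀ {n m l : ℕ} (i j : ℕ), i < n → j < m →
    ∀ x ∈ grading n, ∀ y ∈ grading m, ∀ z ∈ grading l,
    comp (i + j) (comp i x y) z = comp i x (comp j y z)
  /-- the parallel composition axiom -/
  par : ∀ {n m l : ℕ} (i k : ℕ), i < k → k < n →
    ∀ x ∈ grading n, ∀ y ∈ grading m, ∀ z ∈ grading l,
    comp (k + m - 1) (comp i x y) z = comp i (comp k x z) y
  /-- the unitality axiom, left -/
  unit_left : ∀ x : A, comp 0 idp x = x
  /-- the unitality axiom, right -/
  unit_right : ∀ {n : ℕ} (i : ℕ), i < n → ∀ x ∈ grading n, comp i x idp = x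

namespace NsOperad

variable {K : Type u} [Field K] {A : Type u} [AddCommGroup A] [Module K A]

/-- Iterated insertion `(⋯(x ∘_{j_k} y_k) ∘_{j_{k-1}} y_{k-1} ⋯) ∘_{j₁} y₁`
(inserting at the last position first). -/
def multiIns (O : NsOperad K A) : ∀ k : ℕ, A → (Fin k → ℕ) → (Fin k → A) → A
  | 0, x, _, _ => x
  | (k + 1), x, j, y =>
      O.multiIns k (O.comp (j (Fin.last k)) x (y (Fin.last k)))
        (fun l => j l.castSucc) (fun l => y l.castSucc)

open Classical in
/-- The operadic brace operations `x{y₁,…,y_k}` on `W_P = ⊕ₙ P(n)[-n]`, for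
`x` of degree `p` and `y_l` of degree `q l`: the sum over all order-preserving insertions
of `y₁,…,y_k` into the `p` inputs of `x`, with the Gerstenhaber–Voronov signs. -/
def brace (O : NsOperad K A) (p : ℕ) {k : ℕ} (q : Fin k → ℕ) (x : A) (y : Fin k → A) : A :=
  ∑ j ∈ Finset.univ.filter (fun j : Fin k → Fin p => StrictMono j),
    sgn K (∑ l : Fin k,
        (((j l : ℕ) : ℤ) - ((l : ℕ) : ℤ) +
          ∑ r ∈ Finset.univ.filter (fun r : Fin k => r < l), ((q r : ℕ) : ℤ)) *
        (((q l : ℕ) : ℤ) - 1)) •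
      O.multiIns k x (fun l => (j l : ℕ)) y

end NsOperad
set_option linter.unusedSectionVars false
namespace NsOperad

variable {K : Type u} [Field K] {A : Type u} [AddCommGroup A] [Module K A]

theorem sgn_zero' : sgn K 0 = 1 := by simp [sgn]
theorem sgn_add' (a b : ℤ) : sgn K (a + b) = sgn K a * sgn K b := by
  simp [sgn, zpow_add]
theorem sgn_even' {a : ℤ} (h : Even a) : sgn K a = 1 := by
  simp [sgn, h.neg_one_zpow]
theorem sgn_congr' {a b : ℤ} (h : Even (a - b)) : sgn K a = sgn K b := by
  have : a = (a - b) + b := by ring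
  rw [this, sgn_add', sgn_even' h, one_mul]

/-- total shifted degree -/
def dl : List (ℤ × A) → ℤ
  | [] => 0
  | y :: Y => (y.1 - 1) + dl Y

@[simp] theorem dl_nil : dl ([] : List (ℤ × A)) = 0 := rfl
@[simp] theorem dl_cons (y : ℤ × A) (Y) : dl (y :: Y) = (y.1 - 1) + dl Y := rfl
theorem dl_append (X Y : List (ℤ × A)) : dl (X ++ Y) = dl X + dl Y := by
  induction X with
  | nil => simp
  | cons a X ih => simp [ih]; ring
theorem dl_take_drop (r : ℕ) (Z : List (ℤ × A)) : dl (Z.take r) + dl (Z.drop r) = dl Z := by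
  rw [← dl_append, List.take_append_drop]

/-- truncated braces on lists, the head of the list being the last argument -/
def tb (O : NsOperad K A) : ℕ → A → List (ℤ × A) → A
  | _, x, [] => x
  | 0, _, _ :: _ => 0
  | s + 1, x, y :: Y => tb O s x (y :: Y) +
      sgn K ((s + dl Y) * (y.1 - 1)) • tb O s (O.comp s x y.2) Y

@[simp] theorem tb_nil (O : NsOperad K A) (s : ℕ) (x : A) : O.tb s x [] = x := by
  cases s <;> rfl
@[simp] theorem tb_zero_cons (O : NsOperad K A) (x : A) (y Y) : O.tb 0 x (y :: Y) = 0 := rfl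
theorem tb_succ_cons (O : NsOperad K A) (s : ℕ) (x : A) (y Y) :
    O.tb (s + 1) x (y :: Y) = O.tb s x (y :: Y) +
      sgn K ((s + dl Y) * (y.1 - 1)) • O.tb s (O.comp s x y.2) Y := rfl

theorem tb_x_zero (O : NsOperad K A) (s : ℕ) (Y) : O.tb s 0 Y = 0 := by
  induction s generalizing Y with
  | zero => cases Y <;> simp
  | succ s ih => cases Y with
    | nil => simp
    | cons y Y => simp [tb_succ_cons, ih]

theorem tb_x_zero' (O : NsOperad K A) (s : ℕ) : O.tb s 0 = fun _ => 0 :=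
  funext fun Y => O.tb_x_zero s Y

theorem tb_x_add (O : NsOperad K A) (s : ℕ) (x x' : A) (Y) :
    O.tb s (x + x') Y = O.tb s x Y + O.tb s x' Y := by
  induction s generalizing Y x x' with
  | zero => cases Y <;> simp
  | succ s ih => cases Y with
    | nil => simp
    | cons y Y => simp [tb_succ_cons, ih]; abel

theorem tb_x_smul (O : NsOperad K A) (s : ℕ) (c : K) (x : A) (Y) :
    O.tb s (c • x) Y = c • O.tb s x Y := by
  induction s generalizing Y x with
  | zero => cases Y <;> simp
  | succ s ih => cases Y with
    | nil => simp
    | cons y Y => simp [tb_succ_cons, ih, smul_comm c]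

theorem tb_short (O : NsOperad K A) (s : ℕ) (x : A) (Y) (h : s < Y.length) :
    O.tb s x Y = 0 := by
  induction s generalizing Y x with
  | zero => cases Y <;> simp_all
  | succ s ih => cases Y with
    | nil => simp at h
    | cons y Y =>
      simp at h
      simp [tb_succ_cons, ih _ Y h, ih _ (y :: Y) (by simp; omega)]

theorem tb_arg_zero (O : NsOperad K A) (s : ℕ) (x : A) (Y) (h : ∃ y ∈ Y, y.2 = 0) :
    O.tb s x Y = 0 := by
  induction s generalizing Y x with
  | zero => cases Y <;> simp_all
  | succ s ih => cases Y with
    | nil => simp at h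
    | cons y Y =>
      rw [tb_succ_cons, ih _ _ h]
      obtain ⟨a, ha, h0⟩ := h
      rcases List.mem_cons.1 ha with rfl | ha
      · simp [h0, tb_x_zero]
      · rw [ih _ Y ⟨a, ha, h0⟩]; simp

/-- homogeneous lists -/
def Hom (O : NsOperad K A) (Y : List (ℤ × A)) : Prop :=
  ∀ y ∈ Y, ∃ n : ℕ, y.1 = n ∧ y.2 ∈ O.grading n

theorem Hom.of_cons {O : NsOperad K A} {y Y} (h : O.Hom (y :: Y)) : O.Hom Y :=
  fun a ha => h a (List.mem_cons_of_mem _ ha)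
theorem Hom.head {O : NsOperad K A} {y : ℤ × A} {Y} (h : O.Hom (y :: Y)) :
    ∃ n : ℕ, y.1 = n ∧ y.2 ∈ O.grading n := h y List.mem_cons_self
theorem Hom.take {O : NsOperad K A} {Y} (h : O.Hom Y) (r) : O.Hom (Y.take r) :=
  fun a ha => h a (List.mem_of_mem_take ha)
theorem Hom.drop {O : NsOperad K A} {Y} (h : O.Hom Y) (r) : O.Hom (Y.drop r) :=
  fun a ha => h a (List.mem_of_mem_drop ha)
theorem Hom.dl_ge {O : NsOperad K A} {Y} (h : O.Hom Y) : -(Y.length : ℤ) ≤ dl Y := by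
  induction Y with
  | nil => simp
  | cons y Y ih =>
    obtain ⟨n, hn, -⟩ := h.head
    have := ih h.of_cons
    simp only [dl_cons, List.length_cons]; push_cast; omega

theorem tb_mem (O : NsOperad K A) (s : ℕ) {d : ℕ} {x : A} (hx : x ∈ O.grading d) (hs : s ≤ d)
    {Y} (hY : O.Hom Y) {D : ℕ} (hD : (D : ℤ) = d + dl Y) : O.tb s x Y ∈ O.grading D := by
  induction s generalizing Y x d with
  | zero => cases Y with
    | nil => simp at hD; subst hD; simpa
    | cons y Y => simp
  | succ s ih => cases Y with
    | nil => simp at hD; subst hD; simpa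
    | cons y Y =>
      obtain ⟨n, hn, hy⟩ := hY.head
      rw [tb_succ_cons]
      refine Submodule.add_mem _ (ih hx (by omega) hY hD) (Submodule.smul_mem _ _ ?_)
      refine ih (O.comp_grade s (by omega) _ hx _ hy) (by omega) hY.of_cons ?_
      simp at hD
      omega

theorem tb_par (O : NsOperad K A) (s u : ℕ) {d c : ℕ} {x z : A} (hx : x ∈ O.grading d)
    (hz : z ∈ O.grading c) (hs : s ≤ u) (hu : u < d) {Y} (hY : O.Hom Y) :
    O.tb s (O.comp u x z) Y = O.comp ((u : ℤ) + dl Y).toNat (O.tb s x Y) z := by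
  induction s generalizing Y x d u with
  | zero => cases Y with
    | nil => simp
    | cons y Y => simp
  | succ s ih => cases Y with
    | nil => simp
    | cons y Y =>
      obtain ⟨n, hn, hy⟩ := hY.head
      rw [tb_succ_cons, tb_succ_cons, ih u hx (by omega) hu hY]
      have hp := O.par s u (by omega) hu x hx _ hy z hz
      rw [← hp, ih (u + n - 1) (O.comp_grade s (by omega) _ hx _ hy) (by omega) (by omega)
        hY.of_cons]
      have : ((u + n - 1 : ℕ) : ℤ) + dl Y = u + dl (y :: Y) := by
        simp only [dl_cons]; omega
      rw [this]; simp

theorem tb_seq (O : NsOperad K A) (t u : ℕ) {d c : ℕ} {w y : A} (hw : w ∈ O.grading d)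
    (hy : y ∈ O.grading c) (ht : t ≤ c) (hu : u < d) {Z} (hZ : O.Hom Z) :
    O.tb (u + t) (O.comp u w y) Z = ∑ r ∈ Finset.range (Z.length + 1),
      sgn K ((u + dl (Z.drop r)) * dl (Z.take r)) •
        O.tb u (O.comp u w (O.tb t y (Z.take r))) (Z.drop r) := by
  induction t generalizing Z y c with
  | zero =>
    rw [Finset.sum_eq_single 0]
    · simp [sgn_zero']
    · intro r hr h0
      rw [tb_short O 0 y (Z.take r)]
      · simp [tb_x_zero]
      · simp at hr ⊢; omega
    · simp
  | succ t ih => cases Z with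
    | nil => simp [sgn_zero']
    | cons z Z =>
      obtain ⟨n, hn, hz⟩ := hZ.head
      rw [← add_assoc, tb_succ_cons, ih hy (by omega) hZ,
        O.seq u t hu (by omega) w hw y hy _ hz,
        ih (O.comp_grade t (by omega) _ hy _ hz) (by omega) hZ.of_cons]
      rw [List.length_cons, Finset.sum_range_succ', Finset.sum_range_succ' _ (Z.length + 1)]
      simp only [List.take_succ_cons, List.drop_succ_cons, List.take_zero, List.drop_zero, tb_nil,
        tb_succ_cons, map_add, map_smul, tb_x_add, tb_x_smul, smul_add, Finset.sum_add_distrib,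
        Finset.smul_sum, smul_smul, ← sgn_add', dl_cons]
      rw [add_right_comm]
      congr 2
      refine Finset.sum_congr rfl fun r _ => ?_
      congr 2
      rw [← dl_take_drop r Z]
      push_cast
      ring

/-- labelled brace -/
def bl (O : NsOperad K A) (y : ℤ × A) (M : List (ℤ × A)) : ℤ × A :=
  (y.1 + dl M, O.tb y.1.toNat y.2 M)

/-- sum over words -/
def wsum (O : NsOperad K A) : (List (ℤ × A) → A) → List (ℤ × A) → List (ℤ × A) → A
  | F, [], Z => F Z
  | F, y :: Y, Z => ∑ t ∈ Finset.range (Z.length + 1), ∑ r ∈ Finset.range (Z.length - t + 1),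
      sgn K ((y.1 - 1) * dl (Z.drop (t + r))) •
        wsum O (fun W => F (Z.take t ++ O.bl y ((Z.drop t).take r) :: W)) Y (Z.drop (t + r))

theorem wsum_nil (O : NsOperad K A) (F Z) : O.wsum F [] Z = F Z := rfl
theorem wsum_cons (O : NsOperad K A) (F y Y Z) : O.wsum F (y :: Y) Z =
    ∑ t ∈ Finset.range (Z.length + 1), ∑ r ∈ Finset.range (Z.length - t + 1),
      sgn K ((y.1 - 1) * dl (Z.drop (t + r))) •
        O.wsum (fun W => F (Z.take t ++ O.bl y ((Z.drop t).take r) :: W)) Y (Z.drop (t + r)) := rfl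

theorem wsum_congr (O : NsOperad K A) (F F' : List (ℤ × A) → A) (Y Z)
    (h : ∀ W, dl W = dl Y + dl Z → F W = F' W) : O.wsum F Y Z = O.wsum F' Y Z := by
  induction Y generalizing F F' Z with
  | nil => exact h Z (by simp)
  | cons y Y ih =>
    rw [wsum_cons, wsum_cons]
    refine Finset.sum_congr rfl fun t _ => Finset.sum_congr rfl fun r _ => ?_
    congr 1
    refine ih _ _ _ fun W hW => h _ ?_
    rw [dl_append, dl_cons, dl_cons, hW, bl]
    have h1 := dl_take_drop t Z
    have h2 := dl_take_drop r (Z.drop t)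
    rw [List.drop_drop] at h2
    simp only
    linarith

theorem wsum_add (O : NsOperad K A) (F F' : List (ℤ × A) → A) (Y Z) :
    O.wsum (fun W => F W + F' W) Y Z = O.wsum F Y Z + O.wsum F' Y Z := by
  induction Y generalizing F F' Z with
  | nil => rfl
  | cons y Y ih =>
    simp only [wsum_cons, ih, smul_add, Finset.sum_add_distrib]

theorem wsum_smul (O : NsOperad K A) (c : K) (F : List (ℤ × A) → A) (Y Z) :
    O.wsum (fun W => c • F W) Y Z = c • O.wsum F Y Z := by
  induction Y generalizing F Z with
  | nil => rfl
  | cons y Y ih =>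
    simp only [wsum_cons, ih, Finset.smul_sum, smul_comm c]

theorem wsum_zero (O : NsOperad K A) (Y Z) :
    O.wsum (fun _ => 0) Y Z = 0 := by
  have := O.wsum_smul 0 (fun _ => 0) Y Z
  simpa using this

theorem wsum_cons_nil (O : NsOperad K A) (F y Y) :
    O.wsum F (y :: Y) [] = O.wsum (fun W => F (O.bl y [] :: W)) Y [] := by
  simp [wsum_cons, sgn_zero']

theorem wsum_cons_cons (O : NsOperad K A) (F y Y z Z) :
    O.wsum F (y :: Y) (z :: Z) =
     ∑ r ∈ Finset.range ((z :: Z).length + 1), sgn K ((y.1 - 1) * dl ((z :: Z).drop r)) •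
        O.wsum (fun W => F (O.bl y ((z :: Z).take r) :: W)) Y ((z :: Z).drop r)
     + O.wsum (fun W => F (z :: W)) (y :: Y) Z := by
  rw [wsum_cons, Finset.sum_range_succ', add_comm]
  congr 1
  · simp
  · rw [wsum_cons, List.length_cons]
    refine Finset.sum_congr rfl fun t _ => ?_
    simp [Nat.add_right_comm t 1]

theorem main_list (O : NsOperad K A) (s : ℕ) {d : ℕ} {x : A} (hx : x ∈ O.grading d) (hs : s ≤ d)
    {Y Z} (hY : O.Hom Y) (hZ : O.Hom Z) :
    O.tb ((s : ℤ) + dl Y).toNat (O.tb s x Y) Z = O.wsum (fun W => O.tb s x W) Y Z := by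
  induction s generalizing Y Z x d with
  | zero => cases Y with
    | nil => simp [wsum_nil]
    | cons y Y =>
      simp only [tb_zero_cons, tb_x_zero, wsum_cons]
      symm
      refine Finset.sum_eq_zero fun t _ => Finset.sum_eq_zero fun r _ => ?_
      rw [wsum_congr O _ (fun _ => 0), wsum_zero, smul_zero]
      intro W _
      exact tb_short _ _ _ _ (by simp)
  | succ s ih =>
    -- the part coming from a `z` in the last slot
    have hstep : ∀ {Y Z : List (ℤ × A)} {z : ℤ × A}, O.Hom Y → O.Hom (z :: Z) →
        O.tb (((s + 1 : ℕ) : ℤ) + dl Y).toNat (O.tb s x Y) (z :: Z) =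
        O.tb ((s : ℤ) + dl Y).toNat (O.tb s x Y) (z :: Z) +
        O.wsum (fun W => sgn K ((s + dl W) * (z.1 - 1)) • O.tb s (O.comp s x z.2) W) Y Z := by
      intro Y Z z hY hZ
      obtain ⟨n, hn, hz⟩ := hZ.head
      rw [wsum_congr O _ (fun W => sgn K ((s + (dl Y + dl Z)) * (z.1 - 1)) •
        O.tb s (O.comp s x z.2) W) _ _ (fun W hW => by rw [hW])]
      rw [wsum_smul, ← ih (O.comp_grade s (by omega) _ hx _ hz) (by omega) hY hZ.of_cons,
        O.tb_par s s hx hz le_rfl (by omega) hY]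
      by_cases hl : s < Y.length
      · rw [tb_short O s x Y hl]; simp [tb_x_zero]
      · have h1 := hY.dl_ge
        have h2 : (((s + 1 : ℕ) : ℤ) + dl Y).toNat = ((s : ℤ) + dl Y).toNat + 1 := by omega
        rw [h2, tb_succ_cons]
        congr 3
        have : ((((s : ℤ) + dl Y).toNat : ℕ) : ℤ) = s + dl Y := by omega
        rw [this]; ring
    have hyst : ∀ {Y : List (ℤ × A)} {y : ℤ × A}, O.Hom (y :: Y) →
        sgn K ((s + dl Y) * (y.1 - 1)) • O.tb (((s + 1 : ℕ) : ℤ) + dl (y :: Y)).toNat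
          (O.tb s (O.comp s x y.2) Y) Z =
        ∑ r ∈ Finset.range (Z.length + 1), sgn K ((y.1 - 1) * dl (Z.drop r)) •
          O.wsum (fun W => sgn K ((s + dl W) * ((O.bl y (Z.take r)).1 - 1)) •
            O.tb s (O.comp s x (O.bl y (Z.take r)).2) W) Y (Z.drop r) := by
      intro Y y hY
      obtain ⟨n, hn, hy⟩ := hY.head
      have hY' := hY.of_cons
      by_cases hl : s < Y.length
      · rw [tb_short O s _ Y hl]
        simp only [tb_x_zero, smul_zero]
        symm
        refine Finset.sum_eq_zero fun r hr => ?_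
        rw [wsum_congr O _ (fun W => sgn K ((s + (dl Y + dl (Z.drop r))) *
          ((O.bl y (Z.take r)).1 - 1)) • O.tb s (O.comp s x (O.bl y (Z.take r)).2) W) _ _
            (fun W hW => by rw [hW])]
        rw [wsum_smul]
        by_cases hb : n < (Z.take r).length
        · have : (O.bl y (Z.take r)).2 = 0 := by
            simp only [bl]; rw [hn]; exact tb_short _ _ _ _ (by simpa using hb)
          rw [this]
          simp only [map_zero, tb_x_zero', tb_x_zero, wsum_zero, smul_zero]
        · have h1 := (hZ.take r).dl_ge
          have hm : (O.bl y (Z.take r)).2 ∈ O.grading (((n : ℤ) + dl (Z.take r)).toNat) := by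
            simp only [bl]; rw [hn]
            exact tb_mem O _ hy (by simp) (hZ.take r) (by omega)
          rw [← ih (O.comp_grade s (by omega) _ hx _ hm) (by omega) hY' (hZ.drop r),
            tb_short O s _ Y hl]
          simp [tb_x_zero]
      · have h1 := hY'.dl_ge
        have e1 : (((s + 1 : ℕ) : ℤ) + dl (y :: Y)).toNat = ((s : ℤ) + dl Y).toNat + n := by
          simp only [dl_cons]; omega
        have e2 : ((((s : ℤ) + dl Y).toNat : ℕ) : ℤ) = s + dl Y := by omega
        rw [e1, O.tb_par s s hx hy le_rfl (by omega) hY',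
          O.tb_seq n _ (d := ((d : ℤ) + dl Y).toNat)
            (tb_mem O s hx (by omega) hY' (by omega)) hy le_rfl (by omega) hZ, Finset.smul_sum]
        refine Finset.sum_congr rfl fun r hr => ?_
        rw [wsum_congr O _ (fun W => sgn K ((s + (dl Y + dl (Z.drop r))) *
          ((O.bl y (Z.take r)).1 - 1)) • O.tb s (O.comp s x (O.bl y (Z.take r)).2) W) _ _
            (fun W hW => by rw [hW])]
        rw [wsum_smul]
        have hb2 : (O.bl y (Z.take r)).2 = O.tb n y.2 (Z.take r) := by simp [bl, hn]
        by_cases hb : n < (Z.take r).length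
        · rw [hb2, tb_short _ _ _ _ hb]
          simp only [map_zero, tb_x_zero', tb_x_zero, wsum_zero, smul_zero]
        · have h1 := (hZ.take r).dl_ge
          have hm : O.tb n y.2 (Z.take r) ∈ O.grading (((n : ℤ) + dl (Z.take r)).toNat) :=
            tb_mem O _ hy (by simp) (hZ.take r) (by omega)
          rw [hb2, ← ih (O.comp_grade s (by omega) _ hx _ hm) (by omega) hY' (hZ.drop r),
            O.tb_par s s hx hm le_rfl (by omega) hY', smul_smul, smul_smul, ← sgn_add',
            ← sgn_add', e2]
          congr 1
          apply sgn_congr'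
          simp only [bl]
          refine ⟨-((y.1 - 1) * dl (Z.drop r)), ?_⟩
          ring
    cases Y with
    | nil => cases Z with
      | nil => simp [wsum_nil]
      | cons z Z => simp [wsum_nil]
    | cons y Y =>
      rw [tb_succ_cons, tb_x_add, tb_x_smul, hyst hY]
      cases Z with
      | nil =>
        simp only [wsum_cons_nil, tb_succ_cons, wsum_add]
        rw [← wsum_cons_nil O (fun W => O.tb s x W), ← ih hx (by omega) hY hZ]
        simp [sgn_zero']
      | cons z Z =>
        rw [hstep hY hZ, ih hx (by omega) hY hZ]
        rw [wsum_cons_cons, wsum_cons_cons]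
        simp only [tb_succ_cons, wsum_add, smul_add, Finset.sum_add_distrib]
        abel

end NsOperad

namespace NsOperad

theorem raw1 : ∀ (n : ℕ) (i r : Fin n → ℕ) (m : ℕ), (∀ a b, a < b → i a + r a ≤ i b) →
    (∀ a, i a + r a ≤ m) → ∑ a, r a ≤ m
  | 0, _, _, _, _, _ => by simp
  | n + 1, i, r, m, h1, h2 => by
    have := raw1 n (fun a => i a.castSucc) (fun a => r a.castSucc) (i (Fin.last n))
      (fun a b hab => h1 _ _ (by simpa using hab)) (fun a => h1 _ _ (Fin.castSucc_lt_last a))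
    have := h2 (Fin.last n)
    rw [Fin.sum_univ_castSucc]; omega

theorem filt_castSucc {n : ℕ} (r : Fin (n + 1) → ℕ) (p : Fin n) :
    ∑ a ∈ Finset.univ.filter (fun a : Fin (n + 1) => a < p.castSucc), r a =
    ∑ a ∈ Finset.univ.filter (fun a : Fin n => a < p), r a.castSucc := by
  rw [Finset.sum_filter, Finset.sum_filter, Fin.sum_univ_castSucc]
  simp [(Fin.castSucc_lt_last p).not_gt]

theorem filt_last {n : ℕ} (r : Fin (n + 1) → ℕ) :
    ∑ a ∈ Finset.univ.filter (fun a : Fin (n + 1) => a < Fin.last n), r a =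
    ∑ a : Fin n, r a.castSucc := by
  rw [Finset.sum_filter, Fin.sum_univ_castSucc]
  simp [Fin.castSucc_lt_last]

theorem raw2 : ∀ (n : ℕ) (i r : Fin n → ℕ) (m : ℕ), (∀ a b, a < b → i a + r a ≤ i b) →
    (∀ a, i a + r a ≤ m) → ∀ p,
    i p + ∑ a, r a ≤ m + ∑ a ∈ Finset.univ.filter (fun a => a < p), r a
  | 0, _, _, _, _, _ => fun p => p.elim0
  | n + 1, i, r, m, h1, h2 => by
    have ih := raw2 n (fun a => i a.castSucc) (fun a => r a.castSucc) (i (Fin.last n))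
      (fun a b hab => h1 _ _ (by simpa using hab)) (fun a => h1 _ _ (Fin.castSucc_lt_last a))
    have := h2 (Fin.last n)
    intro p
    rw [Fin.sum_univ_castSucc]
    induction p using Fin.lastCases with
    | last => rw [filt_last]; omega
    | cast p => have := ih p; rw [filt_castSucc]; omega

theorem raw3 : ∀ (n : ℕ) (i r : Fin n → ℕ), (∀ a b, a < b → i a + r a ≤ i b) → ∀ p,
    ∑ a ∈ Finset.univ.filter (fun a => a < p), r a ≤ i p
  | 0, _, _, _ => fun p => p.elim0
  | n + 1, i, r, h1 => by
    have ih := raw3 n (fun a => i a.castSucc) (fun a => r a.castSucc)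
      (fun a b hab => h1 _ _ (by simpa using hab))
    intro p
    induction p using Fin.lastCases with
    | last => 
      rw [filt_last]
      exact raw1 n (fun a => i a.castSucc) (fun a => r a.castSucc) (i (Fin.last n))
        (fun a b hab => h1 _ _ (by simpa using hab)) (fun a => h1 _ _ (Fin.castSucc_lt_last a))
    | cast p => rw [filt_castSucc]; exact ih p

/-- add a last `(i, r)` to insertion data -/
def sn {n i m : ℕ} (r : ℕ) (h : i + r ≤ m) (ins : InsData n i) : InsData (n + 1) m :=
  ⟨(Fin.snoc (α := fun _ => Fin (m + 1)) (fun a => (⟨ins.1.1 a, by omega⟩ : Fin (m + 1)))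
      (⟨i, by omega⟩ : Fin (m + 1)),
    Fin.snoc (α := fun _ => Fin (m + 1)) (fun a => (⟨ins.1.2 a, by omega⟩ : Fin (m + 1)))
      (⟨r, by omega⟩ : Fin (m + 1))), by
    refine ⟨fun a b hab => ?_, fun a => ?_⟩
    · induction b using Fin.lastCases with
      | last =>
        induction a using Fin.lastCases with
        | last => simp at hab
        | cast a => simpa using ins.2.2 a
      | cast b =>
        induction a using Fin.lastCases with
        | last => exact absurd hab (Fin.castSucc_lt_last b).not_gt
        | cast a => simpa using ins.2.1 a b (by simpa using hab)
    · induction a using Fin.lastCases with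
      | last => simpa using h
      | cast a => have := ins.2.2 a; simp; omega⟩

section
variable {n i m : ℕ} (r : ℕ) (h : i + r ≤ m) (ins : InsData n i)

@[simp] theorem sn_i_cast (a : Fin n) : ((sn r h ins).1.1 a.castSucc : ℕ) = ins.1.1 a := by
  simp [sn]
@[simp] theorem sn_r_cast (a : Fin n) : ((sn r h ins).1.2 a.castSucc : ℕ) = ins.1.2 a := by
  simp [sn]
@[simp] theorem sn_i_last : ((sn r h ins).1.1 (Fin.last n) : ℕ) = i := by
  simp [sn]
@[simp] theorem sn_r_last : ((sn r h ins).1.2 (Fin.last n) : ℕ) = r := by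
  simp [sn]
theorem sum_r_le : ∑ a, (ins.1.2 a : ℕ) ≤ i := raw1 _ _ _ _ ins.2.1 ins.2.2
theorem oPos_cast (p : Fin n) : oPos (sn r h ins) p.castSucc = oPos ins p := by
  simp only [oPos, filt_castSucc (fun a => ((sn r h ins).1.2 a : ℕ)), sn_i_cast, sn_r_cast]
  simp
theorem oPos_last : oPos (sn r h ins) (Fin.last n) = n + i - ∑ a, (ins.1.2 a : ℕ) := by
  simp only [oPos, filt_last (fun a => ((sn r h ins).1.2 a : ℕ)), sn_i_last, sn_r_cast]
  simp [add_comm]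
theorem oPos_lt (p : Fin n) : oPos ins p < n + i - ∑ a, (ins.1.2 a : ℕ) := by
  have h1 := raw2 _ _ _ _ ins.2.1 ins.2.2 p
  have h2 := raw3 _ _ _ ins.2.1 p
  have h3 := sum_r_le ins
  have := p.isLt
  simp only [oPos]
  omega
end

theorem sn_surj {n m : ℕ} (ins : InsData (n + 1) m) (i r : ℕ)
    (hi : (ins.1.1 (Fin.last n) : ℕ) = i) (hr : (ins.1.2 (Fin.last n) : ℕ) = r) (h : i + r ≤ m) :
    ∃ ins' : InsData n i, sn r h ins' = ins := by
  have hb : ∀ a : Fin n, (ins.1.1 a.castSucc : ℕ) + ins.1.2 a.castSucc ≤ i := fun a =>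
    hi ▸ ins.2.1 _ _ (Fin.castSucc_lt_last a)
  refine ⟨⟨(fun a => ⟨ins.1.1 a.castSucc, by have := hb a; omega⟩,
    fun a => ⟨ins.1.2 a.castSucc, by have := hb a; omega⟩), ?_, ?_⟩, ?_⟩
  · intro a b hab
    exact ins.2.1 _ _ (by simpa using hab)
  · exact hb
  · apply Subtype.ext
    refine Prod.ext (funext fun a => ?_) (funext fun a => ?_) <;> apply Fin.ext
    · induction a using Fin.lastCases with
      | last => exact (sn_i_last r h _).trans hi.symm
      | cast a => exact sn_i_cast r h _ a
    · induction a using Fin.lastCases with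
      | last => exact (sn_r_last r h _).trans hr.symm
      | cast a => exact sn_r_cast r h _ a

theorem sn_ex {n m : ℕ} (ins : InsData (n + 1) m) :
    ∃ (i r : ℕ) (h : i + r ≤ m) (ins' : InsData n i), ins = sn r h ins' := by
  obtain ⟨ins', h⟩ := sn_surj ins _ _ rfl rfl (ins.2.2 _)
  exact ⟨_, _, _, ins', h.symm⟩

theorem sn_inj {n i m : ℕ} (r : ℕ) (h : i + r ≤ m) :
    Function.Injective (sn (n := n) r h) := by
  intro a b hab
  apply Subtype.ext
  refine Prod.ext (funext fun p => ?_) (funext fun p => ?_) <;> apply Fin.ext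
  · rw [← sn_i_cast r h a, hab, sn_i_cast]
  · rw [← sn_r_cast r h a, hab, sn_r_cast]

theorem oPos_inj : ∀ {n m : ℕ} (ins : InsData n m), Function.Injective (oPos ins)
  | 0, _, _ => fun p => p.elim0
  | n + 1, m, ins => by
    obtain ⟨i, r, h0, ins', rfl⟩ := sn_ex ins
    have ih := oPos_inj ins'
    intro p q hpq
    induction p using Fin.lastCases with
    | last => 
      induction q using Fin.lastCases with
      | last => rfl
      | cast q => 
        rw [oPos_cast, oPos_last] at hpq
        exact absurd hpq (oPos_lt ins' q).ne'
    | cast p => 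
      induction q using Fin.lastCases with
      | last =>
        rw [oPos_cast, oPos_last] at hpq
        exact absurd hpq (oPos_lt ins' p).ne
      | cast q => 
        rw [oPos_cast, oPos_cast] at hpq
        rw [ih hpq]

section
variable {W : Type u} [AddCommGroup W] (μf : ∀ k : ℕ, W → (Fin k → W) → W)

theorem insArgs_hit {n m : ℕ} (ins : InsData n m) (y : Fin n → W) (z : Fin m → W)
    (t : Fin (n + m - ∑ a : Fin n, (ins.1.2 a : ℕ))) (p : Fin n) (hp : oPos ins p = (t : ℕ)) :
    insArgs μf ins y z t = μf (ins.1.2 p) (y p)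
      (fun s => z ⟨(ins.1.1 p : ℕ) + s, by have := ins.2.2 p; omega⟩) := by
  have h : ∃ p : Fin n, oPos ins p = (t : ℕ) := ⟨p, hp⟩
  have hc : h.choose = p := oPos_inj ins (h.choose_spec.trans hp.symm)
  unfold insArgs
  rw [dif_pos h]
  have : ∀ (q : Fin n), q = p → μf (ins.1.2 q) (y q)
      (fun s => z ⟨(ins.1.1 q : ℕ) + s, by have := ins.2.2 q; omega⟩) = μf (ins.1.2 p) (y p)
      (fun s => z ⟨(ins.1.1 p : ℕ) + s, by have := ins.2.2 p; omega⟩) := by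
    rintro q rfl; rfl
  exact this _ hc

/-- index of a `z` -/
def zi {n m : ℕ} (ins : InsData n m) (t : ℕ) : ℕ := t
        - (Finset.univ.filter (fun p : Fin n => oPos ins p < t)).card
        + ∑ p ∈ Finset.univ.filter (fun p : Fin n => oPos ins p < t), (ins.1.2 p : ℕ)

theorem insArgs_miss {n m : ℕ} (ins : InsData n m) (y : Fin n → W) (z : Fin m → W)
    (t : Fin (n + m - ∑ a : Fin n, (ins.1.2 a : ℕ))) (hp : ¬ ∃ p, oPos ins p = (t : ℕ)) :
    insArgs μf ins y z t = if hx : zi ins t < m then z ⟨zi ins t, hx⟩ else 0 := by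
  unfold insArgs
  rw [dif_neg hp]
  rfl

theorem zi_low {n i m : ℕ} (r : ℕ) (h : i + r ≤ m) (ins : InsData n i) (t : ℕ)
    (ht : t < n + i - ∑ a, (ins.1.2 a : ℕ)) : zi (sn r h ins) t = zi ins t := by
  simp only [zi, Finset.card_filter, Finset.sum_filter, Fin.sum_univ_castSucc, oPos_cast,
    oPos_last, sn_r_cast, sn_r_last, if_neg ht.not_gt]
  simp

theorem zi_full {n m : ℕ} (ins : InsData n m) (t : ℕ)
    (ht : ∀ p, oPos ins p < t) : zi ins t = t - n + ∑ a, (ins.1.2 a : ℕ) := by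
  simp only [zi, ht]
  simp

theorem card_oPos_lt {n m : ℕ} (ins : InsData n m) (t : ℕ) :
    (Finset.univ.filter (fun p : Fin n => oPos ins p < t)).card ≤ t := by
  have := Finset.card_le_card_of_injOn (s := Finset.univ.filter (fun p : Fin n => oPos ins p < t))
    (t := Finset.range t) (oPos ins) (by intro p; simp) ((oPos_inj ins).injOn)
  simpa using this

theorem zi_lt : ∀ {n m : ℕ} (ins : InsData n m) (t : ℕ) (_ : t < n + m - ∑ a, (ins.1.2 a : ℕ))
    (_ : ¬ ∃ p, oPos ins p = t), zi ins t < m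
  | 0, m, ins, t, ht, hp => by
    rw [zi_full _ _ (fun p => p.elim0)]
    simp at ht ⊢; omega
  | n + 1, m, ins, t, ht, hp => by
    obtain ⟨i, r, h0, ins', rfl⟩ := sn_ex ins
    have hs := sum_r_le ins'
    have hlast := oPos_last r h0 ins'
    rw [Fin.sum_univ_castSucc] at ht
    simp only [sn_r_cast, sn_r_last] at ht
    rcases lt_trichotomy t (n + i - ∑ a, (ins'.1.2 a : ℕ)) with h | h | h
    · rw [zi_low _ _ _ _ h]
      have := zi_lt ins' t h (fun ⟨p, hp'⟩ => hp ⟨p.castSucc, by rw [oPos_cast, hp']⟩)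
      omega
    · exact absurd ⟨Fin.last n, hlast.trans h.symm⟩ hp
    · rw [zi_full]
      · rw [Fin.sum_univ_castSucc]
        simp only [sn_r_cast, sn_r_last]
        omega
      · intro p
        induction p using Fin.lastCases with
        | last => omega
        | cast p => rw [oPos_cast]; exact (oPos_lt ins' p).trans h

theorem ofFn_insArgs_zero {m : ℕ} (ins : InsData 0 m) (y : Fin 0 → W) (z : Fin m → W) :
    List.ofFn (insArgs μf ins y z) = List.ofFn z := by
  apply List.ext_getElem
  · simp
  · intro t h1 h2
    simp at h2
    have hz : zi ins t = t := by rw [zi_full _ _ (fun p => p.elim0)]; simp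
    rw [List.getElem_ofFn, List.getElem_ofFn, insArgs_miss _ _ _ _ _ (fun ⟨p, _⟩ => p.elim0)]
    simp [hz, h2]

theorem ofFn_insArgs_sn {n i m : ℕ} (r : ℕ) (h : i + r ≤ m) (ins : InsData n i)
    (y : Fin (n + 1) → W) (z : Fin m → W) :
    List.ofFn (insArgs μf (sn r h ins) y z) =
      List.ofFn (insArgs μf ins (fun a => y a.castSucc) (fun b => z ⟨b, by omega⟩)) ++
      μf r (y (Fin.last n)) (fun s => z ⟨i + s, by omega⟩) :: (List.ofFn z).drop (i + r) := by
  have hs := sum_r_le ins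
  have hsum : ∑ a, ((sn r h ins).1.2 a : ℕ) = ∑ a, (ins.1.2 a : ℕ) + r := by
    rw [Fin.sum_univ_castSucc]; simp
  apply List.ext_getElem
  · simp only [List.length_ofFn, List.length_append, List.length_cons, List.length_drop]
    omega
  · intro t h1 h2
    have h1' : t < n + 1 + m - ∑ a, ((sn r h ins).1.2 a : ℕ) := by simpa using h1
    rw [List.getElem_ofFn]
    rcases lt_trichotomy t (n + i - ∑ a, (ins.1.2 a : ℕ)) with ht | ht | ht
    · rw [List.getElem_append_left (by simpa using ht), List.getElem_ofFn]
      by_cases hp : ∃ p, oPos ins p = t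
      · obtain ⟨p, hp⟩ := hp
        rw [insArgs_hit μf ins _ _ _ p hp,
          insArgs_hit μf (sn r h ins) _ _ _ p.castSucc (by rw [oPos_cast, hp])]
        congr 1
        · simp
        · have e1 := sn_r_cast r h ins p
          have e2 := sn_i_cast r h ins p
          congr! 1
          · rw [e1]
          · rename_i a b hab
            refine congrArg z (Fin.ext ?_)
            have : (a : ℕ) = b := by
              have := (Fin.heq_ext_iff e1).1 hab
              exact this
            simp [this]
      · have hlt := zi_lt ins t ht hp
        rw [insArgs_miss μf ins _ _ _ hp, insArgs_miss]
        · simp only [zi_low _ _ _ _ ht]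
          rw [dif_pos hlt, dif_pos (by omega)]
        · rintro ⟨p, hp'⟩
          induction p using Fin.lastCases with
          | last => rw [oPos_last] at hp'; simp only at hp'; omega
          | cast p => rw [oPos_cast] at hp'; exact hp ⟨p, hp'⟩
    · rw [List.getElem_append_right (by simp [ht])]
      simp only [List.length_ofFn, ← ht, Nat.sub_self, List.getElem_cons_zero]
      rw [insArgs_hit μf (sn r h ins) _ _ _ (Fin.last n) (by rw [oPos_last]; exact ht.symm)]
      have e1 := sn_r_last r h ins
      have e2 := sn_i_last r h ins
      congr 1
      congr! 1
      · rw [e1]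
      · rename_i a b hab
        refine congrArg z (Fin.ext ?_)
        have : (a : ℕ) = b := (Fin.heq_ext_iff e1).1 hab
        simp [this]
    · rw [List.getElem_append_right (by simp; omega)]
      have hall : ∀ p, oPos (sn r h ins) p < t := by
        intro p
        induction p using Fin.lastCases with
        | last => rw [oPos_last]; exact ht
        | cast p => rw [oPos_cast]; exact (oPos_lt ins p).trans ht
      have hz := zi_full _ _ hall
      rw [insArgs_miss _ _ _ _ _ (by rintro ⟨p, hp⟩; exact (hall p).ne hp)]
      simp only [hz, List.length_ofFn]
      rw [dif_pos (by omega), List.getElem_cons, dif_neg (by omega), List.getElem_drop,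
        List.getElem_ofFn]
      congr 2
      omega

end

end NsOperad

namespace NsOperad

variable {K : Type u} [Field K] {A : Type u} [AddCommGroup A] [Module K A]

theorem sum_filt_castLE {M : Type*} [AddCommMonoid M] {i m k : ℕ} (hi : i ≤ m) (hk : k ≤ i)
    (g : Fin m → M) :
    ∑ q ∈ Finset.univ.filter (fun q : Fin m => (q : ℕ) < k), g q =
    ∑ q ∈ Finset.univ.filter (fun q : Fin i => (q : ℕ) < k), g ⟨q, by omega⟩ := by
  symm
  refine Finset.sum_bij (fun q _ => ⟨q, by omega⟩) ?_ ?_ ?_ ?_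
  · intro q hq; simpa using hq
  · intro a _ b _ hab; simpa [Fin.ext_iff] using hab
  · intro b hb
    simp at hb
    exact ⟨⟨b, by omega⟩, by simpa using hb, rfl⟩
  · intros; rfl

theorem insExp_sn {n i m : ℕ} (r : ℕ) (h : i + r ≤ m) (ins : InsData n i)
    (e : Fin (n + 1) → ℤ) (f : Fin m → ℤ) :
    insExp (sn r h ins) e f =
      insExp ins (fun a => e a.castSucc) (fun b => f ⟨b, by omega⟩) +
      (e (Fin.last n) + 1) * ∑ q : Fin i, (f ⟨q, by omega⟩ + 1) := by
  unfold insExp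
  rw [Fin.sum_univ_castSucc]
  congr 1
  · refine Finset.sum_congr rfl fun p _ => ?_
    congr 1
    rw [sn_i_cast]
    exact sum_filt_castLE (by omega) (by omega) (fun q => f q + 1)
  · congr 1
    rw [sn_i_last, sum_filt_castLE (i := i) (by omega) le_rfl (fun q => f q + 1)]
    simp

theorem dl_reverse (X : List (ℤ × A)) : dl X.reverse = dl X := by
  induction X with
  | nil => rfl
  | cons a X ih => simp [dl_append, ih]; ring

theorem dl_ofFn {k : ℕ} (f : Fin k → ℤ × A) : dl (List.ofFn f) = ∑ l, ((f l).1 - 1) := by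
  induction k with
  | zero => simp
  | succ k ih => rw [List.ofFn_succ, dl_cons, ih, Fin.sum_univ_succ]

/-- labelled brace operations -/
def blf (O : NsOperad K A) (k : ℕ) (w : ℤ × A) (ws : Fin k → ℤ × A) : ℤ × A :=
  O.bl w (List.ofFn ws).reverse

theorem even_sum_sub {ι : Type*} (s : Finset ι) (f g : ι → ℤ) (h : ∀ i ∈ s, Even (f i - g i)) :
    Even (∑ i ∈ s, f i - ∑ i ∈ s, g i) := by
  rw [← Finset.sum_sub_distrib]
  exact Finset.even_sum _ h

theorem sum_split {n m : ℕ} (f : InsData (n + 1) m → A) (g : ℕ → ℕ → A)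
    (hg : ∀ t r (h : m - (t + r) + r ≤ m), t + r ≤ m →
      ∑ ins : InsData n (m - (t + r)), f (sn r h ins) = g t r) :
    ∑ ins, f ins = ∑ t ∈ Finset.range (m + 1), ∑ r ∈ Finset.range (m - t + 1), g t r := by
  rw [Finset.sum_sigma', ← Finset.sum_fiberwise_of_maps_to
    (g := fun ins : InsData (n + 1) m => (⟨m - ((ins.1.1 (Fin.last n) : ℕ) + ins.1.2 (Fin.last n)),
      (ins.1.2 (Fin.last n) : ℕ)⟩ : Σ _ : ℕ, ℕ))]
  · refine Finset.sum_congr rfl ?_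
    rintro ⟨t, r⟩ htr
    simp at htr
    have hle : m - (t + r) + r ≤ m := by omega
    rw [← hg t r hle (by omega)]
    symm
    refine Finset.sum_bij (fun ins _ => sn r hle ins) ?_ ?_ ?_ ?_
    · intro ins _
      simp only [Finset.mem_filter, Finset.mem_univ, true_and, sn_i_last, sn_r_last]
      congr 1
      omega
    · intro a _ b _ hab
      exact sn_inj r hle hab
    · intro ins hins
      simp only [Finset.mem_filter, Finset.mem_univ, true_and, Sigma.mk.injEq, heq_eq_eq] at hins
      have := ins.2.2 (Fin.last n)
      obtain ⟨ins', h'⟩ := sn_surj ins (m - (t + r)) r (by omega) hins.2 hle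
      exact ⟨ins', Finset.mem_univ _, h'⟩
    · intros; rfl
  · intro ins _
    have := ins.2.2 (Fin.last n)
    simp
    omega

theorem rev_ofFn_succ {W : Type*} {n : ℕ} (Y : Fin (n + 1) → W) :
    (List.ofFn Y).reverse = Y (Fin.last n) :: (List.ofFn fun a : Fin n => Y a.castSucc).reverse := by
  rw [List.ofFn_succ']
  simp

theorem take_ofFn' {W : Type*} {m i : ℕ} (hi : i ≤ m) (Z : Fin m → W) :
    (List.ofFn Z).take i = List.ofFn (fun b : Fin i => Z ⟨b, by omega⟩) := by
  apply List.ext_getElem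
  · simp; omega
  · intro t h1 h2; simp

theorem mid_ofFn {W : Type*} {m i r : ℕ} (h : i + r ≤ m) (Z : Fin m → W) :
    ((List.ofFn Z).drop i).take r = List.ofFn (fun b : Fin r => Z ⟨i + b, by omega⟩) := by
  apply List.ext_getElem
  · simp; omega
  · intro t h1 h2; simp

theorem sum_ins (O : NsOperad K A) : ∀ (n : ℕ) {m : ℕ} (Y : Fin n → ℤ × A) (Z : Fin m → ℤ × A)
    (F : List (ℤ × A) → A),
    ∑ ins : InsData n m, sgn K (insExp ins (fun a => (Y a).1) (fun b => (Z b).1)) •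
      F (List.ofFn (insArgs O.blf ins Y Z)).reverse =
    O.wsum F (List.ofFn Y).reverse (List.ofFn Z).reverse
  | 0, m, Y, Z, F => by
    have ins0 : InsData 0 m := ⟨(fun a => a.elim0, fun a => a.elim0), fun a => a.elim0,
      fun a => a.elim0⟩
    have hu : ∀ ins : InsData 0 m, ins = ins0 := fun ins => Subtype.ext
      (Prod.ext (funext fun a => a.elim0) (funext fun a => a.elim0))
    rw [Finset.sum_eq_single ins0 (fun b _ hb => absurd (hu b) hb) (by simp)]
    rw [ofFn_insArgs_zero]
    simp [insExp, sgn_zero', wsum_nil]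
  | n + 1, m, Y, Z, F => by
    rw [rev_ofFn_succ, wsum_cons]
    simp only [List.length_reverse, List.length_ofFn]
    refine sum_split _ _ fun t r h htr => ?_
    have e1 : (List.ofFn Z).reverse.drop (t + r) =
        (List.ofFn fun b : Fin (m - (t + r)) => Z ⟨b, by omega⟩).reverse := by
      rw [List.drop_reverse, List.length_ofFn, take_ofFn' (by omega)]
    have e2 : (List.ofFn Z).reverse.take t = ((List.ofFn Z).drop (m - (t + r) + r)).reverse := by
      rw [List.take_reverse, List.length_ofFn]
      congr 2; omega
    have e3 : ((List.ofFn Z).reverse.drop t).take r =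
        (List.ofFn fun b : Fin r => Z ⟨m - (t + r) + b, by omega⟩).reverse := by
      rw [List.drop_reverse, List.take_reverse, List.length_ofFn, ← mid_ofFn h]
      congr 1
      rw [List.drop_take, List.length_take, List.length_ofFn]
      congr 2 <;> omega
    rw [e1, e2, e3, ← sum_ins O n, Finset.smul_sum]
    refine Finset.sum_congr rfl fun ins _ => ?_
    rw [smul_smul, ← sgn_add', ofFn_insArgs_sn, insExp_sn]
    congr 1
    · apply sgn_congr'
      rw [dl_reverse, dl_ofFn]
      have : Even (∑ q : Fin (m - (t + r)), ((Z ⟨q, by omega⟩).1 + 1) -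
        ∑ q : Fin (m - (t + r)), ((Z ⟨q, by omega⟩).1 - 1)) :=
          even_sum_sub _ _ _ (fun i _ => ⟨1, by ring⟩)
      obtain ⟨c, hc⟩ := this
      rw [sub_eq_iff_eq_add] at hc
      rw [hc]
      generalize ∑ q : Fin (m - (t + r)), ((Z ⟨q, _⟩).1 - 1) = s
      refine ⟨((Y (Fin.last n)).1 + 1) * c + s, ?_⟩
      ring
    · congr 1
      simp [blf]

/-! ### the bridge -/

theorem multiIns_add (O : NsOperad K A) : ∀ (k : ℕ) (x x' : A) (j : Fin k → ℕ) (y : Fin k → A),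
    O.multiIns k (x + x') j y = O.multiIns k x j y + O.multiIns k x' j y
  | 0, _, _, _, _ => rfl
  | k + 1, x, x', j, y => by simp [multiIns, multiIns_add O k]

theorem multiIns_smul (O : NsOperad K A) : ∀ (k : ℕ) (c : K) (x : A) (j : Fin k → ℕ)
    (y : Fin k → A), O.multiIns k (c • x) j y = c • O.multiIns k x j y
  | 0, _, _, _, _ => rfl
  | k + 1, c, x, j, y => by simp [multiIns, multiIns_smul O k]

theorem upd_cast {k : ℕ} (y : Fin (k + 1) → A) (i : Fin k) (a : A) :
    (fun l : Fin k => Function.update y i.castSucc a l.castSucc) =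
      Function.update (fun l : Fin k => y l.castSucc) i a := by
  funext l
  simp only [Function.update_apply, Fin.castSucc_inj]

theorem upd_last {k : ℕ} (y : Fin (k + 1) → A) (a : A) :
    (fun l : Fin k => Function.update y (Fin.last k) a l.castSucc) =
      (fun l : Fin k => y l.castSucc) := by
  funext l
  simp [Function.update_apply, (Fin.castSucc_lt_last l).ne]

theorem multiIns_upd_add (O : NsOperad K A) : ∀ (k : ℕ) (x : A) (j : Fin k → ℕ) (y : Fin k → A)
    (i : Fin k) (a b : A), O.multiIns k x j (Function.update y i (a + b)) =
      O.multiIns k x j (Function.update y i a) + O.multiIns k x j (Function.update y i b)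
  | 0, _, _, _, i, _, _ => i.elim0
  | k + 1, x, j, y, i, a, b => by
    induction i using Fin.lastCases with
    | last => simp [multiIns, upd_last, multiIns_add]
    | cast i => simp [multiIns, upd_cast, multiIns_upd_add O k, (Fin.castSucc_lt_last i).ne']

theorem multiIns_upd_smul (O : NsOperad K A) : ∀ (k : ℕ) (x : A) (j : Fin k → ℕ) (y : Fin k → A)
    (i : Fin k) (c : K) (a : A), O.multiIns k x j (Function.update y i (c • a)) =
      c • O.multiIns k x j (Function.update y i a)
  | 0, _, _, _, i, _, _ => i.elim0
  | k + 1, x, j, y, i, c, a => by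
    induction i using Fin.lastCases with
    | last => simp [multiIns, upd_last, multiIns_smul]
    | cast i => simp [multiIns, upd_cast, multiIns_upd_smul O k, (Fin.castSucc_lt_last i).ne']

/-- exponent of the brace sign -/
def bexp {k : ℕ} (q : Fin k → ℕ) (j : Fin k → ℕ) : ℤ :=
  ∑ l : Fin k, (((j l : ℕ) : ℤ) - ((l : ℕ) : ℤ) +
          ∑ r ∈ Finset.univ.filter (fun r : Fin k => r < l), ((q r : ℕ) : ℤ)) *
        (((q l : ℕ) : ℤ) - 1)

open Classical in
theorem brace_def (O : NsOperad K A) (p : ℕ) {k : ℕ} (q : Fin k → ℕ) (x : A) (y : Fin k → A) :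
    O.brace p q x y = ∑ j ∈ Finset.univ.filter (fun j : Fin k → Fin p => StrictMono j),
      sgn K (bexp q (fun l => (j l : ℕ))) • O.multiIns k x (fun l => (j l : ℕ)) y := rfl

theorem bexp_succ {k : ℕ} (q : Fin (k + 1) → ℕ) (j : Fin (k + 1) → ℕ) :
    bexp q j = (j (Fin.last k) + ∑ l : Fin k, ((q l.castSucc : ℤ) - 1)) * (q (Fin.last k) - 1) +
      bexp (fun l => q l.castSucc) (fun l => j l.castSucc) := by
  unfold bexp
  rw [Fin.sum_univ_castSucc, add_comm]
  congr 1
  · congr 1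
    rw [Finset.sum_filter, Fin.sum_univ_castSucc]
    simp [Fin.castSucc_lt_last]
    ring
  · refine Finset.sum_congr rfl fun l _ => ?_
    congr 2
    rw [Finset.sum_filter, Fin.sum_univ_castSucc, Finset.sum_filter]
    simp [(Fin.castSucc_lt_last l).not_gt]

open Classical in
theorem sum_strictMono_succ (k p : ℕ) (f : (Fin (k + 1) → ℕ) → A) :
    ∑ j ∈ Finset.univ.filter (fun j : Fin (k + 1) → Fin (p + 1) => StrictMono j),
      f (fun l => (j l : ℕ)) =
    ∑ j ∈ Finset.univ.filter (fun j : Fin (k + 1) → Fin p => StrictMono j),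
      f (fun l => (j l : ℕ)) +
    ∑ j ∈ Finset.univ.filter (fun j : Fin k → Fin p => StrictMono j),
      f (Fin.snoc (α := fun _ => ℕ) (fun l => (j l : ℕ)) p) := by
  rw [← Finset.sum_filter_not_add_sum_filter _
    (fun j : Fin (k + 1) → Fin (p + 1) => j (Fin.last k) = Fin.last p)]
  congr 1
  · symm
    refine Finset.sum_bij (fun j _ l => (j l).castSucc) ?_ ?_ ?_ ?_
    · intro j hj
      simp only [Finset.mem_filter, Finset.mem_univ, true_and] at hj ⊢
      exact ⟨fun a b hab => by simpa using hj hab, (Fin.castSucc_lt_last _).ne⟩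
    · intro a _ b _ hab
      funext l
      simpa using congrFun hab l
    · intro j hj
      simp only [Finset.mem_filter, Finset.mem_univ, true_and] at hj
      have hlt : ∀ l, (j l : ℕ) < p := by
        intro l
        have h1 : j l ≤ j (Fin.last k) := hj.1.monotone (Fin.le_last l)
        have h2 : (j (Fin.last k) : ℕ) ≠ p := fun h => hj.2 (Fin.ext h)
        have h3 := (j (Fin.last k)).isLt
        have h4 : (j l : ℕ) ≤ j (Fin.last k) := h1
        omega
      refine ⟨fun l => ⟨j l, hlt l⟩, ?_, ?_⟩
      · simp only [Finset.mem_filter, Finset.mem_univ, true_and]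
        exact fun a b hab => hj.1 hab
      · funext l; rfl
    · intros; rfl
  · symm
    refine Finset.sum_bij (fun j _ => Fin.snoc (α := fun _ => Fin (p + 1))
      (fun l => (j l).castSucc) (Fin.last p)) ?_ ?_ ?_ ?_
    · intro j hj
      simp only [Finset.mem_filter, Finset.mem_univ, true_and] at hj ⊢
      refine ⟨fun a b hab => ?_, by simp⟩
      induction b using Fin.lastCases with
      | last =>
        induction a using Fin.lastCases with
        | last => simp at hab
        | cast a => simp [Fin.castSucc_lt_last]
      | cast b =>
        induction a using Fin.lastCases with
        | last => exact absurd hab (Fin.castSucc_lt_last b).not_gt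
        | cast a => simpa using hj (by simpa using hab)
    · intro a _ b _ hab
      funext l
      simpa using congrFun hab l.castSucc
    · intro j hj
      simp only [Finset.mem_filter, Finset.mem_univ, true_and] at hj
      have hlt : ∀ l : Fin k, (j l.castSucc : ℕ) < p := by
        intro l
        have h1 : j l.castSucc < j (Fin.last k) := hj.1 (Fin.castSucc_lt_last l)
        rw [hj.2] at h1
        exact h1
      refine ⟨fun l => ⟨j l.castSucc, hlt l⟩, ?_, ?_⟩
      · simp only [Finset.mem_filter, Finset.mem_univ, true_and]
        exact fun a b hab => hj.1 (by simpa using hab)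
      · funext l
        induction l using Fin.lastCases with
        | last => simp [hj.2]
        | cast l => simp
    · intro j _
      congr 1
      funext l
      induction l using Fin.lastCases with
      | last => simp
      | cast l => simp

theorem brace_eq_tb (O : NsOperad K A) (p : ℕ) {k : ℕ} (q : Fin k → ℕ) (x : A) (y : Fin k → A) :
    O.brace p q x y = O.tb p x (List.ofFn fun l => ((q l : ℤ), y l)).reverse := by
  induction p generalizing k x with
  | zero => cases k with
    | zero =>
      rw [brace_def, Finset.sum_eq_single (fun a => a.elim0)]
      · simp [bexp, sgn_zero', multiIns]
      · intro b _ hb; exact absurd (funext fun a => a.elim0) hb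
      · intro h; exact absurd (Finset.mem_filter.2 ⟨Finset.mem_univ _, fun a => a.elim0⟩) h
    | succ k =>
      rw [rev_ofFn_succ, brace_def, tb_zero_cons]
      exact Finset.sum_eq_zero fun j _ => (j 0).elim0
  | succ p ih => cases k with
    | zero =>
      rw [brace_def, Finset.sum_eq_single (fun a => a.elim0)]
      · simp [bexp, sgn_zero', multiIns]
      · intro b _ hb; exact absurd (funext fun a => a.elim0) hb
      · intro h; exact absurd (Finset.mem_filter.2 ⟨Finset.mem_univ _, fun a => a.elim0⟩) h
    | succ k =>
      rw [rev_ofFn_succ, tb_succ_cons, ← ih, ← rev_ofFn_succ (fun l => ((q l : ℤ), y l)), ← ih,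
        brace_def, sum_strictMono_succ k p (fun j => sgn K (bexp q j) • O.multiIns (k + 1) x j y),
        brace_def, brace_def, Finset.smul_sum]
      congr 1
      refine Finset.sum_congr rfl fun j _ => ?_
      rw [bexp_succ, smul_smul, ← sgn_add', dl_reverse, dl_ofFn]
      simp [multiIns]

end NsOperad

namespace NsOperad

variable {K : Type u} [Field K] {A : Type u} [AddCommGroup A] [Module K A]

theorem brace_add (O : NsOperad K A) (p : ℕ) {k : ℕ} (q : Fin k → ℕ) (x x' : A) (y : Fin k → A) :
    O.brace p q (x + x') y = O.brace p q x y + O.brace p q x' y := by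
  rw [brace_eq_tb, brace_eq_tb, brace_eq_tb, tb_x_add]

theorem brace_smul (O : NsOperad K A) (p : ℕ) {k : ℕ} (q : Fin k → ℕ) (c : K) (x : A)
    (y : Fin k → A) : O.brace p q (c • x) y = c • O.brace p q x y := by
  rw [brace_eq_tb, brace_eq_tb, tb_x_smul]

theorem brace_upd_add (O : NsOperad K A) (p : ℕ) {k : ℕ} (q : Fin k → ℕ) (x : A) (y : Fin k → A)
    (i : Fin k) (a b : A) : O.brace p q x (Function.update y i (a + b)) =
      O.brace p q x (Function.update y i a) + O.brace p q x (Function.update y i b) := by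
  simp only [brace_def, multiIns_upd_add, smul_add, Finset.sum_add_distrib]

theorem brace_upd_smul (O : NsOperad K A) (p : ℕ) {k : ℕ} (q : Fin k → ℕ) (x : A) (y : Fin k → A)
    (i : Fin k) (c : K) (a : A) : O.brace p q x (Function.update y i (c • a)) =
      c • O.brace p q x (Function.update y i a) := by
  simp only [brace_def, multiIns_upd_smul, Finset.smul_sum]
  exact Finset.sum_congr rfl fun j _ => smul_comm _ _ _

theorem coe_upd (O : NsOperad K A) {k : ℕ} (q : Fin k → ℕ) (y : ∀ l, O.grading (q l)) (i : Fin k)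
    (a : O.grading (q i)) : (fun l => ((Function.update y i a l : O.grading (q l)) : A)) =
      Function.update (fun l => (y l : A)) i (a : A) := by
  funext l
  by_cases h : l = i
  · subst h; simp
  · simp [Function.update_of_ne h]

/-- the brace, multilinear on homogeneous components -/
def bmul (O : NsOperad K A) (p k : ℕ) (q : Fin k → ℕ) :
    A →ₗ[K] MultilinearMap K (fun l : Fin k => O.grading (q l)) A where
  toFun x := MultilinearMap.mk' (fun y => O.brace p q x (fun l => (y l : A)))
    (by intro y i a b
        rw [coe_upd, coe_upd, coe_upd]
        exact O.brace_upd_add p q x _ i _ _)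
    (by intro y i c a
        rw [coe_upd, coe_upd]
        exact O.brace_upd_smul p q x _ i _ _)
  map_add' x x' := by ext y; exact O.brace_add p q x x' _
  map_smul' c x := by ext y; exact O.brace_smul p q c x _

/-- decomposition into homogeneous components -/
def dec (O : NsOperad K A) : A →ₗ[K] DirectSum ℕ (fun n => O.grading n) :=
  (LinearEquiv.ofBijective (DirectSum.coeLinearMap O.grading) O.decomp).symm.toLinearMap

theorem dec_of_mem (O : NsOperad K A) {n : ℕ} {x : A} (hx : x ∈ O.grading n) :
    O.dec x = DirectSum.lof K ℕ (fun n => O.grading n) n ⟨x, hx⟩ := by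
  unfold dec
  rw [LinearEquiv.coe_coe, LinearEquiv.symm_apply_eq]
  exact (DirectSum.coeLinearMap_lof O.grading n ⟨x, hx⟩).symm

/-- auxiliary -/
def fam (O : NsOperad K A) (p k : ℕ) : A →ₗ[K] MultilinearMap K (fun _ : Fin k => A) A :=
  (MultilinearMap.compLinearMapₗ (fun _ : Fin k => O.dec)) ∘ₗ
    (MultilinearMap.fromDirectSumEquiv (R := K) (ι := Fin k) (M' := A)
      (κ := fun _ => ℕ) (M := fun _ n => O.grading n)).toLinearMap ∘ₗ
    (LinearMap.pi (fun q : Fin k → ℕ => O.bmul p k q))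

/-- the brace operations -/
def mu (O : NsOperad K A) (k : ℕ) : A →ₗ[K] MultilinearMap K (fun _ : Fin k => A) A :=
  DirectSum.toModule K ℕ _ (fun p => O.fam p k ∘ₗ (O.grading p).subtype) ∘ₗ O.dec

theorem mu_brace (O : NsOperad K A) (p k : ℕ) (q : Fin k → ℕ) (x : A) (y : Fin k → A)
    (hx : x ∈ O.grading p) (hy : ∀ l, y l ∈ O.grading (q l)) :
    O.mu k x y = O.brace p q x y := by
  have h1 : O.mu k x = O.fam p k x := by
    unfold mu
    rw [LinearMap.comp_apply, dec_of_mem O hx, DirectSum.toModule_lof]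
    rfl
  rw [h1]
  have h2 : O.fam p k x y = MultilinearMap.fromDirectSumEquiv (R := K) (ι := Fin k) (M' := A)
      (κ := fun _ => ℕ) (M := fun _ n => O.grading n) (fun q => O.bmul p k q x)
      (fun i => O.dec (y i)) := rfl
  have h3 : (fun i => O.dec (y i)) = fun i => DirectSum.lof K ℕ (fun n => O.grading n) (q i)
    ((fun l => ⟨y l, hy l⟩ : ∀ l, O.grading (q l)) i) := funext fun i => O.dec_of_mem (hy i)
  rw [h2, h3]
  exact MultilinearMap.fromDirectSumEquiv_lof (R := K) (ι := Fin k) (M' := A)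
      (κ := fun _ => ℕ) (M := fun _ n => O.grading n) (fun q => O.bmul p k q x) q _

/-- the integer grading -/
def gr (O : NsOperad K A) (d : ℤ) : Submodule K A := if 0 ≤ d then O.grading d.toNat else ⊥

theorem gr_nat (O : NsOperad K A) (n : ℕ) : O.gr n = O.grading n := by simp [gr]
theorem gr_neg (O : NsOperad K A) {z : ℤ} (h : z < 0) : O.gr z = ⊥ := by simp [gr, h]

theorem gr_cases {O : NsOperad K A} {x : A} {d : ℤ} (h : x ∈ O.gr d) :
    (∃ n : ℕ, d = n ∧ x ∈ O.grading n) ∨ (d < 0 ∧ x = 0) := by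
  rcases le_or_gt 0 d with hd | hd
  · lift d to ℕ using hd
    rw [gr_nat] at h
    exact Or.inl ⟨d, rfl, h⟩
  · rw [gr_neg O hd] at h
    exact Or.inr ⟨hd, by simpa using h⟩

theorem gr_internal (O : NsOperad K A) : DirectSum.IsInternal O.gr := by
  obtain ⟨hi, ht⟩ := (DirectSum.isInternal_submodule_iff_iSupIndep_and_iSup_eq_top _).1 O.decomp
  refine (DirectSum.isInternal_submodule_iff_iSupIndep_and_iSup_eq_top _).2 ⟨?_, ?_⟩
  · intro i
    rcases le_or_gt 0 i with h | h
    · lift i to ℕ using h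
      rw [gr_nat]
      refine (hi i).mono_right ?_
      refine iSup₂_le fun j hj => ?_
      rcases le_or_gt 0 j with h | h
      · lift j to ℕ using h
        rw [gr_nat]
        exact le_iSup₂_of_le j (by exact_mod_cast hj) le_rfl
      · rw [gr_neg O h]; exact bot_le
    · rw [gr_neg O h]; exact disjoint_bot_left
  · rw [eq_top_iff, ← ht]
    refine iSup_le fun n => ?_
    rw [← gr_nat]
    exact le_iSup O.gr (n : ℤ)

theorem mu_tb (O : NsOperad K A) {k : ℕ} (d : ℤ) (e : Fin k → ℤ) (x : A) (y : Fin k → A)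
    (hx : x ∈ O.gr d) (hy : ∀ l, y l ∈ O.gr (e l)) :
    O.mu k x y = O.tb d.toNat x (List.ofFn fun l => (e l, y l)).reverse := by
  rcases gr_cases hx with ⟨p, rfl, hx⟩ | ⟨_, rfl⟩
  · by_cases h : ∃ l, y l = 0
    · rw [tb_arg_zero]
      · obtain ⟨l, hl⟩ := h
        exact MultilinearMap.map_coord_zero _ l hl
      · obtain ⟨l, hl⟩ := h
        exact ⟨(e l, y l), List.mem_reverse.2 (List.mem_ofFn.2 ⟨l, rfl⟩), hl⟩
    · push Not at h
      have : ∀ l, ∃ n : ℕ, e l = n ∧ y l ∈ O.grading n := fun l =>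
        (gr_cases (hy l)).resolve_right (fun hh => h l hh.2)
      choose q hq hy' using this
      rw [mu_brace O p k q x y hx hy', brace_eq_tb]
      simp [hq]
  · rw [tb_x_zero]; simp

theorem mu_grade (O : NsOperad K A) {k : ℕ} (d : ℤ) (e : Fin k → ℤ) (x : A) (y : Fin k → A)
    (hx : x ∈ O.gr d) (hy : ∀ l, y l ∈ O.gr (e l)) :
    O.mu k x y ∈ O.gr (d + ∑ i, (e i - 1)) := by
  by_cases h0 : O.mu k x y = 0
  · rw [h0]; exact zero_mem _
  have hdl : dl (List.ofFn fun l => (e l, y l)).reverse = ∑ i, (e i - 1) := by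
    rw [dl_reverse, dl_ofFn]
  rw [mu_tb O d e x y hx hy] at h0 ⊢
  rw [← hdl]
  rcases gr_cases hx with ⟨p, rfl, hx⟩ | ⟨_, rfl⟩
  · have hH : O.Hom (List.ofFn fun l => (e l, y l)).reverse := by
      intro w hw
      simp only [List.mem_reverse, List.mem_ofFn] at hw
      obtain ⟨l, rfl⟩ := hw
      refine (gr_cases (hy l)).resolve_right fun hh => h0 ?_
      exact tb_arg_zero _ _ _ _ ⟨(e l, y l), List.mem_reverse.2 (List.mem_ofFn.2 ⟨l, rfl⟩), hh.2⟩
    have h1 := hH.dl_ge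
    have h2 : (List.ofFn fun l => (e l, y l)).reverse.length ≤ p := by
      by_contra hlt
      exact h0 (tb_short _ _ _ _ (by simpa using hlt))
    generalize (List.ofFn fun l => (e l, y l)).reverse = Y at *
    obtain ⟨D, hD⟩ := Int.eq_ofNat_of_zero_le (a := (p : ℤ) + dl Y) (by omega)
    rw [hD, gr_nat]
    exact tb_mem O p hx le_rfl hH hD.symm
  · exact absurd (tb_x_zero _ _ _) h0

theorem mu_zero (O : NsOperad K A) (x : A) : O.mu 0 x ![] = x := by
  have hx : x ∈ ⨆ n, O.grading n := by
    rw [O.decomp.submodule_iSup_eq_top]; trivial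
  induction hx using Submodule.iSup_induction' with
  | mem n x hx =>
    rw [mu_tb O n ![] x ![] (by rwa [gr_nat]) (fun l => l.elim0)]
    simp
  | zero => simp
  | add x y _ _ h1 h2 => rw [map_add, add_apply, h1, h2]

theorem gr_abs {O : NsOperad K A} {x : A} {d : ℤ} (h : x ∈ O.gr d) : x ∈ O.gr |d| := by
  rcases gr_cases h with ⟨n, rfl, hx⟩ | ⟨_, rfl⟩
  · simpa using h
  · exact zero_mem _

theorem even_mul_sub {a b c d : ℤ} (h1 : Even (a - b)) (h2 : Even (c - d)) :
    Even (a * c - b * d) := by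
  obtain ⟨s, hs⟩ := h1
  obtain ⟨t, ht⟩ := h2
  exact ⟨s * c + b * t, by
    rw [sub_eq_iff_eq_add] at hs ht
    rw [hs, ht]; ring⟩

theorem even_sub_abs (a : ℤ) : Even (a - |a|) := by
  rcases abs_choice a with h | h <;> rw [h]
  · simp
  · exact ⟨a, by ring⟩

theorem insExp_abs {n m : ℕ} (ins : InsData n m) (e : Fin n → ℤ) (f : Fin m → ℤ) :
    sgn K (insExp ins e f) = sgn K (insExp ins (fun a => |e a|) (fun b => |f b|)) := by
  apply sgn_congr'
  unfold insExp
  refine even_sum_sub _ _ _ fun p _ => even_mul_sub (by simpa using even_sub_abs (e p)) ?_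
  exact even_sum_sub _ _ _ fun q _ => by simpa using even_sub_abs (f q)

theorem blf_homog (O : NsOperad K A) {k : ℕ} (w : ℤ × A) (ws : Fin k → ℤ × A)
    (hw : w.2 ∈ O.gr w.1) (hws : ∀ l, (ws l).2 ∈ O.gr (ws l).1) :
    (O.blf k w ws).2 = O.mu k w.2 (fun l => (ws l).2) ∧
      (O.blf k w ws).2 ∈ O.gr (O.blf k w ws).1 := by
  have h : (O.blf k w ws).2 = O.mu k w.2 (fun l => (ws l).2) := by
    rw [mu_tb O w.1 (fun l => (ws l).1) _ _ hw hws]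
    rfl
  refine ⟨h, ?_⟩
  rw [h]
  have := mu_grade O w.1 (fun l => (ws l).1) _ _ hw hws
  simp only [blf, bl, dl_reverse, dl_ofFn]
  exact this

theorem insArgs_homog (O : NsOperad K A) {n m : ℕ} (ins : InsData n m) (Y : Fin n → ℤ × A)
    (Z : Fin m → ℤ × A) (hY : ∀ l, (Y l).2 ∈ O.gr (Y l).1) (hZ : ∀ l, (Z l).2 ∈ O.gr (Z l).1) (t) :
    (insArgs O.blf ins Y Z t).2 = insArgs (fun k x y => O.mu k x y) ins (fun a => (Y a).2)
      (fun b => (Z b).2) t ∧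
    (insArgs O.blf ins Y Z t).2 ∈ O.gr (insArgs O.blf ins Y Z t).1 := by
  unfold insArgs
  by_cases h : ∃ p : Fin n, oPos ins p = (t : ℕ)
  · simp only [dif_pos h]
    exact O.blf_homog _ _ (hY _) (fun l => hZ _)
  · simp only [dif_neg h]
    split_ifs
    · exact ⟨rfl, hZ _⟩
    · exact ⟨rfl, zero_mem _⟩

theorem mu_preJacobi (O : NsOperad K A) : IsPreJacobi (fun k x y => O.mu k x y) O.gr := by
  intro n m d e f x y z hx hy hz
  rcases gr_cases hx with ⟨p, rfl, hx'⟩ | ⟨_, rfl⟩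
  swap
  · simp
  have hy' : ∀ a, y a ∈ O.gr |e a| := fun a => gr_abs (hy a)
  have hz' : ∀ a, z a ∈ O.gr |f a| := fun a => gr_abs (hz a)
  simp only [insExp_abs (K := K) _ e f]
  generalize hE : (fun a => |e a|) = E
  generalize hF : (fun a => |f a|) = F
  have hE0 : ∀ a, 0 ≤ E a := fun a => by rw [← hE]; exact abs_nonneg _
  have hF0 : ∀ a, 0 ≤ F a := fun a => by rw [← hF]; exact abs_nonneg _
  replace hy' : ∀ a, y a ∈ O.gr (E a) := fun a => by rw [← hE]; exact hy' a
  replace hz' : ∀ a, z a ∈ O.gr (F a) := fun a => by rw [← hF]; exact hz' a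
  have HY : O.Hom (List.ofFn fun l => (E l, y l)).reverse := by
    intro w hw
    simp only [List.mem_reverse, List.mem_ofFn] at hw
    obtain ⟨l, rfl⟩ := hw
    exact (gr_cases (hy' l)).resolve_right fun hh => absurd (hE0 l) (not_le.2 hh.1)
  have HZ : O.Hom (List.ofFn fun l => (F l, z l)).reverse := by
    intro w hw
    simp only [List.mem_reverse, List.mem_ofFn] at hw
    obtain ⟨l, rfl⟩ := hw
    exact (gr_cases (hz' l)).resolve_right fun hh => absurd (hF0 l) (not_le.2 hh.1)
  rw [mu_tb O _ F _ z (mu_grade O _ E x y hx hy') hz', mu_tb O _ E x y hx hy']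
  have h1 := main_list O p hx' le_rfl HY HZ
  rw [dl_reverse, dl_ofFn] at h1
  rw [Int.toNat_natCast]
  refine h1.trans ?_
  rw [← sum_ins O n (fun l => (E l, y l)) (fun l => (F l, z l)) (fun W => O.tb p x W)]
  refine Finset.sum_congr rfl fun ins _ => ?_
  congr 1
  have key := insArgs_homog O ins (fun l => (E l, y l)) (fun l => (F l, z l)) hy' hz'
  have h2 : insArgs (fun k x y => O.mu k x y) ins y z =
      fun t => (insArgs O.blf ins (fun l => (E l, y l)) (fun l => (F l, z l)) t).2 :=
    funext fun t => (key t).1.symm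
  rw [h2, mu_tb O _ (fun t => (insArgs O.blf ins (fun l => (E l, y l)) (fun l => (F l, z l)) t).1)
    x _ hx (fun t => (key t).2), Int.toNat_natCast]

end NsOperad

/-! ### STATEMENT 2 -/

/-- **Gerstenhaber–Voronov operadic modeling, brace algebra part.**
For every non-symmetric operad `P` over `K`, the graded space `W_P = ⊕ₙ P(n)[-n]`,
equipped with the operadic brace operations, is a brace algebra: `x{} = x`, and the
higher pre-Jacobi identities hold.  (The brace algebra structure `B` below is the one
whose multilinear brace operations agree with the operadic braces on homogeneous
elements, and whose grading is induced by that of the operad.) -/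
theorem operad_to_braceAlgebra
    (K : Type u) [Field K] [CharZero K]
    (A : Type u) [AddCommGroup A] [Module K A]
    (O : NsOperad K A) :
    ∃ B : BraceAlg K A,
      (∀ n : ℕ, B.grading (n : ℤ) = O.grading n) ∧
      (∀ z : ℤ, z < 0 → B.grading z = ⊥) ∧
      (∀ (p k : ℕ) (q : Fin k → ℕ) (x : A) (y : Fin k → A),
        x ∈ O.grading p → (∀ l, y l ∈ O.grading (q l)) →
        B.μ k x y = O.brace p q x y) := by
  exact ⟨{ grading := O.gr
           decomp := O.gr_internal
           μ := O.mu
           μ_grade := fun d e x y hx hy => O.mu_grade d e x y hx hy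
           μ_zero := O.mu_zero
           pre_jacobi := O.mu_preJacobi },
    O.gr_nat, fun _ h => O.gr_neg h, O.mu_brace⟩
end
end
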